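/- arXiv:2304.08568 — 4 statements merged into one kernel-verified Lean document; each statement's English description precedes it below -/
import Mathlib

section
/- Let K be a field and let X, Y, S, S' be schemes that are separated and of finite type over K. Let π : X → Y be an affine morphism, u : S → Y a morphism, p : S' → S a proper surjective morphism, and u' : S' → X a morphism with π ∘ u' = u ∘ p. Then there exist a scheme S'' separated and of finite type over K, a finite surjective morphism q : S'' → S, and a morphism u'' : S'' → X such that π ∘ u'' = u ∘ q. -/
universe u
open Polynomial in
lemma exists_root_ext {K : Type u} [Field K] (q : ℕ) (hq : 0 < q) (s : Finset K) :
    ∃ (K' : Type u) (_ : Field K') (_ : Algebra K K'), FiniteDimensional K K' ∧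
      ∀ c ∈ s, ∃ d : K', d ^ q = algebraMap K K' c := by
  classical
  let f : K[X] := ∏ c ∈ s, (X ^ q - C c)
  refine ⟨f.SplittingField, inferInstance, inferInstance, inferInstance, fun c hc => ?_⟩
  have hf : f ≠ 0 := Finset.prod_ne_zero_iff.mpr fun c _ => (monic_X_pow_sub_C c hq.ne').ne_zero
  have h1 : ((X ^ q - C c : K[X]).map (algebraMap K f.SplittingField)).Splits := by
    refine (SplittingField.splits f).of_dvd (map_ne_zero hf) ?_
    exact Polynomial.map_dvd _ (Finset.dvd_prod_of_mem _ hc)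
  obtain ⟨d, hd⟩ := h1.exists_eval_eq_zero (by
    rw [degree_map, degree_X_pow_sub_C hq]; exact_mod_cast hq.ne')
  refine ⟨d, ?_⟩
  simpa [sub_eq_zero] using hd

lemma exists_root_poly {K : Type u} [Field K] (p e n : ℕ) [ExpChar K p]
    (s : Finset (MvPolynomial (Fin n) K)) :
    ∃ (P' : Type u) (_ : CommRing P') (_ : IsDomain P') (_ : IsIntegrallyClosed P')
      (_ : Algebra (MvPolynomial (Fin n) K) P'), Module.Finite (MvPolynomial (Fin n) K) P' ∧
      Function.Injective (algebraMap (MvPolynomial (Fin n) K) P') ∧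
      ∀ f ∈ s, ∃ g : P', g ^ (p ^ e) = algebraMap _ P' f := by
  classical
  have hq : 0 < p ^ e := pow_pos (expChar_pos K p) e
  obtain ⟨K', _, _, _, hK'⟩ := exists_root_ext (p ^ e) hq (s.biUnion fun f => f.support.image fun m => f.coeff m)
  have : ExpChar K' p := expChar_of_injective_algebraMap (algebraMap K K').injective p
  let φ : MvPolynomial (Fin n) K →+* MvPolynomial (Fin n) K' :=
    (MvPolynomial.expand (p ^ e)).toRingHom.comp (MvPolynomial.map (algebraMap K K'))
  have hC : ∀ c, φ (MvPolynomial.C c) = MvPolynomial.C (algebraMap K K' c) := by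
    intro c; simp [φ]
  have hX : ∀ i, φ (MvPolynomial.X i) = MvPolynomial.X i ^ (p ^ e) := by
    intro c; simp [φ]
  let _ := φ.toAlgebra
  have hinj : Function.Injective φ := by
    have h2 := MvPolynomial.map_injective (σ := Fin n) (algebraMap K K') (algebraMap K K').injective
    have h3 : Function.Injective (MvPolynomial.expand (R := K') (σ := Fin n) (p ^ e)) :=
      MvPolynomial.expand_injective hq
    exact h3.comp h2
  refine ⟨MvPolynomial (Fin n) K', inferInstance, inferInstance, inferInstance, φ.toAlgebra, ?_, hinj, ?_⟩
  · have hint : φ.IsIntegral := by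
      intro g
      have hmem : ∀ g : MvPolynomial (Fin n) K', g ∈ (integralClosure (MvPolynomial (Fin n) K) (MvPolynomial (Fin n) K')).toSubring := by
        intro g
        induction g using MvPolynomial.induction_on with
        | C a =>
          have h0 : IsIntegral K a := Algebra.IsIntegral.isIntegral a
          obtain ⟨P, hP, hP'⟩ := h0
          refine ⟨P.map MvPolynomial.C, hP.map _, ?_⟩
          rw [Polynomial.eval₂_map]
          have : (algebraMap (MvPolynomial (Fin n) K) (MvPolynomial (Fin n) K')).comp MvPolynomial.C
              = MvPolynomial.C.comp (algebraMap K K') := by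
            ext c; exact congrArg _ (hC c)
          rw [this, ← Polynomial.hom_eval₂, hP', map_zero]
        | add a b ha hb => exact add_mem ha hb
        | mul_X a i ha =>
          refine mul_mem ha ?_
          refine IsIntegral.of_pow hq ?_
          rw [← hX]
          exact isIntegral_algebraMap
      exact hmem g
    have hft : φ.FiniteType := by
      have h1 : (φ.comp MvPolynomial.C).FiniteType := by
        have : φ.comp MvPolynomial.C = MvPolynomial.C.comp (algebraMap K K') := by
          ext c; exact congrArg _ (hC c)
        rw [this]
        refine RingHom.FiniteType.comp ?_ ?_
        · exact (RingHom.finiteType_algebraMap (A := K') (B := MvPolynomial (Fin n) K')).mpr inferInstance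
        · exact (RingHom.finiteType_algebraMap).mpr inferInstance
      exact RingHom.FiniteType.of_comp_finiteType h1
    exact hint.to_finite hft
  · intro f hf
    have : φ f ∈ (iterateFrobenius (MvPolynomial (Fin n) K') p e).range := by
      rw [f.as_sum, map_sum]
      refine sum_mem fun m hm => ?_
      rw [MvPolynomial.monomial_eq, map_mul, hC]
      refine mul_mem ?_ ?_
      · obtain ⟨d, hd⟩ := hK' (f.coeff m) (Finset.mem_biUnion.mpr ⟨f, hf, Finset.mem_image_of_mem _ hm⟩)
        exact ⟨MvPolynomial.C d, by rw [iterateFrobenius_def, ← map_pow, hd]⟩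
      · rw [Finsupp.prod, map_prod]
        refine prod_mem fun i _ => ?_
        rw [map_pow, hX]
        exact pow_mem (RingHom.mem_range.mpr ⟨MvPolynomial.X i, by rw [iterateFrobenius_def]⟩) _
    obtain ⟨g, hg⟩ := this
    exact ⟨g, by rw [← iterateFrobenius_def, hg]; rfl⟩

lemma finite_integralClosure_insep {K : Type u} [Field K] (n : ℕ) {F M : Type*} [Field F] [Field M]
    [Algebra (MvPolynomial (Fin n) K) F] [IsFractionRing (MvPolynomial (Fin n) K) F]
    [Algebra F M] [Algebra (MvPolynomial (Fin n) K) M] [IsScalarTower (MvPolynomial (Fin n) K) F M]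
    [FiniteDimensional F M] [IsPurelyInseparable F M] :
    Module.Finite (MvPolynomial (Fin n) K) (integralClosure (MvPolynomial (Fin n) K) M) := by
  classical
  set P := MvPolynomial (Fin n) K with hP
  obtain ⟨p, hp⟩ := ExpChar.exists K
  have : ExpChar P p := expChar_of_injective_algebraMap (algebraMap K P).injective p
  have : ExpChar F p := expChar_of_injective_algebraMap (IsFractionRing.injective P F) p
  let b := Module.finBasis F M
  let e := IsPurelyInseparable.exponent F M
  have h1 : ∀ i, ∃ (m : M) (c : F) (f : P), c ≠ 0 ∧ m = c • b i ∧ m ^ (p ^ e) = algebraMap P M f := by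
    intro i
    obtain ⟨y, hy⟩ := IsPurelyInseparable.exponent_def' F p (b i)
    obtain ⟨r, d, hd, hrd⟩ := IsFractionRing.div_surjective (A := P) y
    have hd0 : algebraMap P F d ≠ 0 := by
      simpa using nonZeroDivisors.ne_zero hd
    refine ⟨_, algebraMap P F d, d ^ (p ^ e - 1) * r, hd0, rfl, ?_⟩
    have hq : 0 < p ^ e := pow_pos (expChar_pos K p) e
    rw [smul_pow, ← hy, Algebra.smul_def, ← map_mul, IsScalarTower.algebraMap_apply P F M]
    congr 1
    rw [← hrd, map_mul, map_pow]
    obtain ⟨k, hk⟩ := Nat.exists_eq_succ_of_ne_zero hq.ne'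
    rw [hk]
    simp only [Nat.succ_eq_add_one, add_tsub_cancel_right, pow_succ]
    field_simp
  choose m c f hc hm hf using h1
  obtain ⟨P', _, _, _, _, hfin, hinj, hroot⟩ := exists_root_poly p e n (Finset.univ.image f)
  let F' := FractionRing P'
  have hinj' : Function.Injective (algebraMap P F') := by
    rw [IsScalarTower.algebraMap_eq P P' F']
    exact (IsFractionRing.injective P' F').comp hinj
  have : ExpChar F' p := expChar_of_injective_algebraMap hinj' p
  let ι : F →+* F' := IsFractionRing.lift hinj'
  let _ : Algebra F F' := ι.toAlgebra
  have : IsScalarTower P F F' := IsScalarTower.of_algebraMap_eq fun x => by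
    exact (IsFractionRing.lift_algebraMap hinj' x).symm
  have hadj : IntermediateField.adjoin F (Set.range m) = ⊤ := by
    rw [eq_top_iff]
    rintro x -
    rw [← b.sum_repr x]
    refine sum_mem fun i _ => ?_
    have : b i = (c i)⁻¹ • m i := by rw [hm, smul_smul, inv_mul_cancel₀ (hc i), one_smul]
    rw [this]
    exact IntermediateField.smul_mem _ (IntermediateField.smul_mem _ (IntermediateField.subset_adjoin _ _ (Set.mem_range_self i)))
  obtain ⟨φ⟩ : Nonempty (M →ₐ[F] F') := by
    refine IntermediateField.nonempty_algHom_of_adjoin_splits (S := Set.range m) ?_ hadj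
    rintro _ ⟨i, rfl⟩
    refine ⟨Algebra.IsIntegral.isIntegral _, ?_⟩
    obtain ⟨g, hg⟩ := hroot (f i) (Finset.mem_image_of_mem _ (Finset.mem_univ i))
    have hq : 0 < p ^ e := pow_pos (expChar_pos K p) e
    have hdvd : minpoly F (m i) ∣ Polynomial.X ^ (p ^ e) - Polynomial.C (algebraMap P F (f i)) := by
      refine minpoly.dvd _ _ ?_
      simp [hf, ← IsScalarTower.algebraMap_apply]
    refine Polynomial.Splits.of_dvd (g := (Polynomial.X ^ (p ^ e) - Polynomial.C (algebraMap P F (f i))).map (algebraMap F F')) ?_ (Polynomial.map_ne_zero (Polynomial.monic_X_pow_sub_C _ hq.ne').ne_zero) (Polynomial.map_dvd _ hdvd)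
    have : (Polynomial.X ^ (p ^ e) - Polynomial.C (algebraMap P F (f i))).map (algebraMap F F')
        = (Polynomial.X - Polynomial.C (algebraMap P' F' g)) ^ (p ^ e) := by
      rw [sub_pow_expChar_pow, ← Polynomial.C_pow, ← map_pow, hg, ← IsScalarTower.algebraMap_apply]
      simp [← IsScalarTower.algebraMap_apply]
      rfl
    rw [this]
    exact (Polynomial.Splits.X_sub_C _).pow _
  have h2 : ∀ x : integralClosure P M, ∃ y : P', algebraMap P' F' y = φ x := by
    rintro ⟨x, hx⟩
    refine IsIntegrallyClosed.isIntegral_iff.mp ?_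
    have : IsIntegral P (φ x) := hx.map (φ.restrictScalars P)
    exact this.tower_top
  choose ψ hψ using h2
  let Ψ : integralClosure P M →ₗ[P] P' :=
    { toFun := ψ
      map_add' := fun x y => IsFractionRing.injective P' F' (by simp [hψ])
      map_smul' := fun r x => IsFractionRing.injective P' F' (by
        simp only [hψ, RingHom.id_apply, Algebra.smul_def, map_mul, ← IsScalarTower.algebraMap_apply]
        simp) }
  refine Module.Finite.of_injective Ψ fun x y hxy => ?_
  have := congrArg (algebraMap P' F') hxy
  change algebraMap P' F' (ψ x) = algebraMap P' F' (ψ y) at this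
  rw [hψ, hψ] at this
  exact Subtype.ext (φ.injective this)

lemma finite_integralClosure_descend {P L N : Type*} [CommRing P] [IsNoetherianRing P] [Field L] [Field N]
    [Algebra P L] [Algebra P N] [Algebra L N] [IsScalarTower P L N]
    (h : Module.Finite P (integralClosure P N)) : Module.Finite P (integralClosure P L) := by
  let Ψ : integralClosure P L →ₗ[P] integralClosure P N :=
    { toFun := fun x => ⟨algebraMap L N x, (x.2.map (IsScalarTower.toAlgHom P L N))⟩
      map_add' := fun x y => Subtype.ext (map_add _ _ _)
      map_smul' := fun r x => Subtype.ext (by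
        change algebraMap L N (r • (x : L)) = r • algebraMap L N x
        rw [Algebra.smul_def, map_mul, ← IsScalarTower.algebraMap_apply, ← Algebra.smul_def]) }
  refine Module.Finite.of_injective Ψ fun x y hxy => ?_
  exact Subtype.ext ((algebraMap L N).injective (congrArg Subtype.val hxy))

lemma finite_integralClosure_sep {P C M N : Type*} [CommRing P] [CommRing C] [IsNoetherianRing P]
    [Field M] [Field N] [Algebra P C] [Algebra C M] [Algebra P M] [IsScalarTower P C M]
    [IsIntegrallyClosed C] [IsDomain C]
    [IsFractionRing C M] [Algebra M N] [Algebra P N] [IsScalarTower P M N]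
    [FiniteDimensional M N] [Algebra.IsSeparable M N] [Module.Finite P C] :
    Module.Finite P (integralClosure P N) := by
  have : IsNoetherianRing C := isNoetherianRing_iff.mpr (isNoetherian_of_tower P inferInstance)
  let _ : Algebra C N := ((algebraMap M N).comp (algebraMap C M)).toAlgebra
  have : IsScalarTower C M N := IsScalarTower.of_algebraMap_eq fun x => rfl
  have : IsScalarTower P C N := IsScalarTower.of_algebraMap_eq fun x => by
    rw [IsScalarTower.algebraMap_apply P M N, IsScalarTower.algebraMap_apply P C M]; rfl
  have h2 : Module.Finite C (integralClosure C N) := IsIntegralClosure.finite C M N _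
  have h3 : Module.Finite P (integralClosure C N) := Module.Finite.trans C _
  let Ψ : integralClosure P N →ₗ[P] integralClosure C N :=
    { toFun := fun x => ⟨x, x.2.tower_top⟩
      map_add' := fun x y => rfl
      map_smul' := fun r x => rfl }
  refine Module.Finite.of_injective Ψ fun x y hxy => ?_
  exact Subtype.ext (congrArg (fun z : integralClosure C N => (z : N)) hxy)

lemma finite_integralClosure_tower {K : Type u} [Field K] (n : ℕ) {F M N : Type*} [Field F] [Field M]
    [Field N]
    [Algebra (MvPolynomial (Fin n) K) F] [IsFractionRing (MvPolynomial (Fin n) K) F]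
    [Algebra F M] [Algebra M N] [Algebra F N] [IsScalarTower F M N]
    [Algebra (MvPolynomial (Fin n) K) N] [IsScalarTower (MvPolynomial (Fin n) K) F N]
    [FiniteDimensional F M] [IsPurelyInseparable F M] [FiniteDimensional M N]
    [Algebra.IsSeparable M N] :
    Module.Finite (MvPolynomial (Fin n) K) (integralClosure (MvPolynomial (Fin n) K) N) := by
  let P := MvPolynomial (Fin n) K
  let _ : Algebra P M := ((algebraMap F M).comp (algebraMap P F)).toAlgebra
  have : IsScalarTower P F M := IsScalarTower.of_algebraMap_eq fun x => rfl
  have : IsScalarTower P M N := IsScalarTower.of_algebraMap_eq fun x => by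
    rw [IsScalarTower.algebraMap_apply P F N, IsScalarTower.algebraMap_apply P F M,
      IsScalarTower.algebraMap_apply F M N]
  have h1 : Module.Finite P (integralClosure P M) := finite_integralClosure_insep n (F := F)
  have : IsFractionRing (integralClosure P M) M :=
    integralClosure.isFractionRing_of_finite_extension F M
  have : IsIntegrallyClosed (integralClosure P M) :=
    integralClosure.isIntegrallyClosedOfFiniteExtension F
  exact finite_integralClosure_sep (P := P) (C := integralClosure P M) (M := M) (N := N)

lemma isPurelyInseparable_fixedField {F N : Type*} [Field F] [Field N] [Algebra F N]
    [FiniteDimensional F N] [Normal F N] :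
    IsPurelyInseparable F (IntermediateField.fixedField (F := F) (E := N) ⊤) := by
  classical
  let M := IntermediateField.fixedField (F := F) (E := N) ⊤
  refine ⟨inferInstance, fun x hx => ?_⟩
  have hsplit : ((minpoly F (x : N)).map (algebraMap F N)).Splits := Normal.splits inferInstance _
  have hmin : minpoly F (x : N) = minpoly F x := minpoly.algebraMap_eq (algebraMap M N).injective x
  have hcard := Polynomial.card_rootSet_eq_natDegree (K := N) (p := minpoly F (x : N)) (hmin ▸ hx) hsplit
  have hsub : (minpoly F (x : N)).rootSet N ⊆ {(x : N)} := by
    intro y hy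
    obtain ⟨σ, hσ⟩ := minpoly.exists_algEquiv_of_root' (K := F) (L := N) (x := y) (y := (x : N))
      (Algebra.IsAlgebraic.isAlgebraic _) (by
        rw [Polynomial.mem_rootSet] at hy
        exact hy.2)
    rw [← hσ]
    exact x.2 ⟨σ, trivial⟩
  have hle : (minpoly F x).natDegree ≤ 1 := by
    rw [← hmin, ← hcard, ← Set.toFinset_card]
    refine (Finset.card_le_card (t := {(x : N)}) ?_).trans (by simp)
    intro y hy
    simpa using hsub (by simpa using hy)
  exact minpoly.natDegree_eq_one_iff.mp (le_antisymm hle (minpoly.natDegree_pos (Algebra.IsIntegral.isIntegral x)))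

lemma finite_integralClosure_normal {K : Type u} [Field K] (n : ℕ) {F N : Type*} [Field F] [Field N]
    [Algebra (MvPolynomial (Fin n) K) F] [IsFractionRing (MvPolynomial (Fin n) K) F]
    [Algebra F N] [Algebra (MvPolynomial (Fin n) K) N] [IsScalarTower (MvPolynomial (Fin n) K) F N]
    [FiniteDimensional F N] [Normal F N] :
    Module.Finite (MvPolynomial (Fin n) K) (integralClosure (MvPolynomial (Fin n) K) N) := by
  have hM := isPurelyInseparable_fixedField (F := F) (N := N)
  have hs : Algebra.IsSeparable (IntermediateField.fixedField (F := F) (E := N) ⊤) N :=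
    FixedPoints.isSeparable (⊤ : Subgroup Gal(N/F)) N
  exact finite_integralClosure_tower (K := K) n (F := F) (N := N)
    (M := IntermediateField.fixedField (F := F) (E := N) ⊤)

lemma finite_integralClosure_poly {K : Type u} [Field K] (n : ℕ) {F L : Type*} [Field F] [Field L]
    [Algebra (MvPolynomial (Fin n) K) F] [IsFractionRing (MvPolynomial (Fin n) K) F]
    [Algebra F L] [Algebra (MvPolynomial (Fin n) K) L] [IsScalarTower (MvPolynomial (Fin n) K) F L]
    [FiniteDimensional F L] :
    Module.Finite (MvPolynomial (Fin n) K) (integralClosure (MvPolynomial (Fin n) K) L) := by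
  let P := MvPolynomial (Fin n) K
  let N := IntermediateField.normalClosure F L (AlgebraicClosure L)
  let _ : Algebra P N := ((algebraMap F N).comp (algebraMap P F)).toAlgebra
  have : IsScalarTower P F N := IsScalarTower.of_algebraMap_eq fun x => rfl
  have : IsScalarTower P L N := IsScalarTower.of_algebraMap_eq fun x => by
    rw [IsScalarTower.algebraMap_apply P F N, IsScalarTower.algebraMap_apply P F L,
      IsScalarTower.algebraMap_apply F L N]
  exact finite_integralClosure_descend (P := P) (L := L) (N := N)
    (finite_integralClosure_normal n (F := F) (N := N))

/-- Finiteness of integral closure for finite type algebras over a field. -/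
lemma finite_integralClosure_of_finiteType {K R k L : Type u} [Field K] [CommRing R] [Algebra K R]
    [Algebra.FiniteType K R] [Field k] [Field L] [Algebra R k] [Algebra k L] [Algebra R L]
    [IsScalarTower R k L] [FiniteDimensional k L]
    (hk : ∀ x : k, ∃ r s : R, algebraMap R k s ≠ 0 ∧ x = algebraMap R k r / algebraMap R k s) :
    Module.Finite R (integralClosure R L) := by
  let R' := R ⧸ RingHom.ker (algebraMap R k)
  have : (RingHom.ker (algebraMap R k)).IsPrime := RingHom.ker_isPrime _
  let i : R' →+* k := RingHom.kerLift _
  have hi : Function.Injective i := RingHom.kerLift_injective _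
  have hiR : ∀ r, i (Ideal.Quotient.mk _ r) = algebraMap R k r := fun r => rfl
  obtain ⟨n, g, hg, hgfin⟩ := exists_finite_inj_algHom_of_fg K R'
  let P := MvPolynomial (Fin n) K
  let F := FractionRing P
  let j : P →+* k := i.comp g.toRingHom
  have hj : Function.Injective j := hi.comp hg
  let _ : Algebra F k := (IsFractionRing.lift hj).toAlgebra
  let _ : Algebra F L := ((algebraMap k L).comp (algebraMap F k)).toAlgebra
  have : IsScalarTower F k L := IsScalarTower.of_algebraMap_eq fun x => rfl
  let _ : Algebra P L := ((algebraMap F L).comp (algebraMap P F)).toAlgebra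
  have : IsScalarTower P F L := IsScalarTower.of_algebraMap_eq fun x => rfl
  have hPL : ∀ x : P, algebraMap P L x = algebraMap k L (j x) := fun x => by
    change algebraMap k L (IsFractionRing.lift hj (algebraMap P F x)) = _
    rw [IsFractionRing.lift_algebraMap]
  let _ : Algebra P R' := g.toRingHom.toAlgebra
  have hPR' : Module.Finite P R' := hgfin
  have hFk : FiniteDimensional F k := by
    obtain ⟨t, ht⟩ := hPR'.fg_top
    let E := IntermediateField.adjoin F (i '' (t : Set R'))
    have hE : FiniteDimensional F E := by
      refine IntermediateField.finiteDimensional_adjoin ?_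
      rintro _ ⟨x, -, rfl⟩
      have hx : IsIntegral P x := Algebra.IsIntegral.isIntegral x
      obtain ⟨Q, hQ, hQ'⟩ := hx
      refine ⟨Q.map (algebraMap P F), hQ.map _, ?_⟩
      rw [Polynomial.eval₂_map]
      have : (algebraMap F k).comp (algebraMap P F) = i.comp (algebraMap P R') := by
        refine RingHom.ext fun y => ?_
        exact IsFractionRing.lift_algebraMap hj _
      rw [this, ← Polynomial.hom_eval₂, hQ', map_zero]
    have hR'E : ∀ x : R', i x ∈ E := by
      intro x
      have hx : x ∈ Submodule.span P (t : Set R') := ht ▸ Submodule.mem_top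
      induction hx using Submodule.span_induction with
      | mem x hx => exact IntermediateField.subset_adjoin _ _ ⟨x, hx, rfl⟩
      | zero => rw [map_zero]; exact zero_mem _
      | add x y _ _ hx hy => rw [map_add]; exact add_mem hx hy
      | smul a x _ hx =>
        rw [Algebra.smul_def, map_mul]
        refine mul_mem ?_ hx
        have : i (algebraMap P R' a) = algebraMap F k (algebraMap P F a) :=
          (IsFractionRing.lift_algebraMap hj _).symm
        rw [this]
        exact E.algebraMap_mem _
    have htop : E = ⊤ := by
      rw [eq_top_iff]
      rintro x -
      obtain ⟨r, s, -, rfl⟩ := hk x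
      exact div_mem (hR'E (Ideal.Quotient.mk _ r)) (hR'E (Ideal.Quotient.mk _ s))
    rw [htop] at hE
    exact Module.Finite.equiv (IntermediateField.topEquiv (F := F) (E := k)).toLinearEquiv
  have : FiniteDimensional F L := Module.Finite.trans k L
  have hfin := finite_integralClosure_poly (K := K) n (F := F) (L := L)
  let _ : Algebra R' L := ((algebraMap k L).comp i).toAlgebra
  have : IsScalarTower R R' L := IsScalarTower.of_algebraMap_eq fun x => by
    rw [IsScalarTower.algebraMap_apply R k L]; rfl
  have : IsScalarTower P R' L := IsScalarTower.of_algebraMap_eq fun x => hPL x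
  have hRR' : Algebra.IsIntegral R R' := Algebra.IsIntegral.of_surjective (Algebra.ofId R R') Ideal.Quotient.mk_surjective
  have hPR'' : Algebra.IsIntegral P R' := inferInstance
  have hint : ∀ x : L, IsIntegral R x ↔ IsIntegral P x := fun x =>
    ⟨fun h => isIntegral_trans (R := P) (A := R') x h.tower_top,
      fun h => isIntegral_trans (R := R) (A := R') x h.tower_top⟩
  have hfg : (Subalgebra.toSubmodule (integralClosure P L)).FG := Module.Finite.iff_fg.mp hfin
  obtain ⟨t, ht⟩ := hfg
  refine Module.Finite.iff_fg (N := Subalgebra.toSubmodule (integralClosure R L)).mpr ⟨t, le_antisymm ?_ ?_⟩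
  · rw [Submodule.span_le]
    intro x hx
    refine (hint x).mpr ?_
    have : x ∈ Subalgebra.toSubmodule (integralClosure P L) := ht ▸ Submodule.subset_span hx
    exact this
  · intro x hx
    have hx' : x ∈ Submodule.span P (t : Set L) := by
      rw [ht]; exact (hint x).mp hx
    clear hx
    induction hx' using Submodule.span_induction with
    | mem x hx => exact Submodule.subset_span hx
    | zero => exact zero_mem _
    | add x y _ _ hx hy => exact add_mem hx hy
    | smul a x _ hx =>
      obtain ⟨r, hr⟩ := Ideal.Quotient.mk_surjective (g a)
      have : a • x = r • x := by
        rw [Algebra.smul_def, Algebra.smul_def, hPL, IsScalarTower.algebraMap_apply R k L, ← hiR, hr]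
        rfl
      rw [this]
      exact Submodule.smul_mem _ _ hx

open AlgebraicGeometry CategoryTheory
open CategoryTheory.Limits

lemma exists_finite_point {S S' : Scheme.{0}} (p : S' ⟶ S) [LocallyOfFiniteType p] [Surjective p] (s : S) :
    ∃ (L : Type) (_ : Field L) (φ : S.residueField s ⟶ CommRingCat.of L) (a : Spec (CommRingCat.of L) ⟶ S'),
      φ.hom.Finite ∧ a ≫ p = Spec.map φ ≫ S.fromSpecResidueField s := by
  obtain ⟨x, hx⟩ := p.surjective s
  have hx' : x ∈ Set.range (p.fiberι s) := by rw [p.range_fiberι]; exact hx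
  obtain ⟨y, -⟩ := hx'
  have : LocallyOfFiniteType (p.fiberToSpecResidueField s) :=
    inferInstanceAs (LocallyOfFiniteType (pullback.snd p (S.fromSpecResidueField s)))
  have hA : ∃ (A : CommRingCat.{0}) (c : Spec A ⟶ p.fiber s) (_ : Spec A), LocallyOfFiniteType c := by
    obtain ⟨z, hz⟩ := (p.fiber s).affineCover.covers y
    have : LocallyOfFiniteType ((p.fiber s).affineCover.f ((p.fiber s).affineCover.idx y)) :=
      inferInstance
    exact ⟨(p.fiber s).affineOpenCover.X ((p.fiber s).affineCover.idx y), (p.fiber s).affineCover.f ((p.fiber s).affineCover.idx y), z,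
      this⟩
  obtain ⟨A, c, z, _⟩ := hA
  obtain ⟨ψ, hψ⟩ := Spec.map_surjective (c ≫ p.fiberToSpecResidueField s)
  have hft : ψ.hom.FiniteType := by
    rw [← HasRingHomProperty.Spec_iff (P := @LocallyOfFiniteType), hψ]; infer_instance
  have : Nontrivial A := PrimeSpectrum.nontrivial z
  obtain ⟨m, hm⟩ := Ideal.exists_maximal A
  let : Field (A ⧸ m) := Ideal.Quotient.field m
  refine ⟨A ⧸ m, inferInstance, ψ ≫ CommRingCat.ofHom (Ideal.Quotient.mk m),
    Spec.map (CommRingCat.ofHom (Ideal.Quotient.mk m)) ≫ c ≫ p.fiberι s, ?_, ?_⟩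
  · have h2 : ((Ideal.Quotient.mk m).comp ψ.hom).FiniteType :=
      hft.comp_surjective Ideal.Quotient.mk_surjective
    have := h2
    simp only [CommRingCat.hom_comp, CommRingCat.hom_ofHom]
    algebraize [(Ideal.Quotient.mk m).comp ψ.hom]
    exact finite_of_finite_type_of_isJacobsonRing _ _
  · rw [Spec.map_comp, hψ]
    simp only [Category.assoc, Scheme.Hom.fiber_fac]

lemma evaluation_frac {S : Scheme.{0}} {U : S.Opens} (hU : IsAffineOpen U) (s : S) (hs : s ∈ U)
    (x : S.residueField s) : ∃ r t : Γ(S, U), S.evaluation U s hs t ≠ 0 ∧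
      x = S.evaluation U s hs r / S.evaluation U s hs t := by
  obtain ⟨y, rfl⟩ := S.residue_surjective s x
  have := hU.isLocalization_stalk ⟨s, hs⟩
  let := TopCat.Presheaf.algebra_section_stalk S.presheaf (U := U) ⟨s, hs⟩
  obtain ⟨r, t, h⟩ := IsLocalization.exists_mk'_eq (hU.primeIdealOf ⟨s, hs⟩).asIdeal.primeCompl y
  have h1 : y * S.presheaf.germ U s hs t = S.presheaf.germ U s hs r := by
    rw [← h]; exact IsLocalization.mk'_spec _ _ _
  have hu : IsUnit (S.presheaf.germ U s hs t) := IsLocalization.map_units (S.presheaf.stalk s) t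
  have h0 : S.evaluation U s hs t ≠ 0 := (hu.map (S.residue s).hom).ne_zero
  refine ⟨r, t, h0, ?_⟩
  rw [eq_div_iff h0]
  have := congrArg (S.residue s) h1
  rw [map_mul] at this
  exact this

lemma appLE_point {S : Scheme.{0}} (U : S.Opens) (s : S) (hs : s ∈ U) {L : CommRingCat.{0}}
    (φ : S.residueField s ⟶ L) (g : Spec L ⟶ S) (hg : g = Spec.map φ ≫ S.fromSpecResidueField s)
    (V) (e) :
    g.appLE U V e = S.evaluation U s hs ≫ φ ≫ (Scheme.ΓSpecIso L).inv ≫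
      (Spec L).presheaf.map (homOfLE le_top).op := by
  have hg' : g = Spec.map (S.residue s ≫ φ) ≫ S.fromSpecStalk s := by
    rw [hg, Spec.map_comp, Category.assoc]; rfl
  subst hg'
  rw [Scheme.Hom.comp_appLE, Scheme.fromSpecStalk_app hs,
    ← Scheme.germ_residue]
  have := Scheme.ΓSpecIso_inv_naturality (S.residue s ≫ φ)
  simp only [Category.assoc] at this ⊢
  rw [reassoc_of% this]
  refine congrArg (fun t ↦ S.presheaf.germ U s hs ≫ (Scheme.ΓSpecIso _).inv ≫ t) ?_
  exact Scheme.Hom.map_appLE (f := Spec.map (S.residue s ≫ φ)) e (homOfLE le_top).op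

lemma ringHom_finite_of_embeds {K R A k L : Type} [Field K] [CommRing R] [CommRing A] [Field k] [Field L]
    (κ : K →+* R) (hκ : κ.FiniteType) (e : R →+* k)
    (hk : ∀ x : k, ∃ r s : R, e s ≠ 0 ∧ x = e r / e s) (φ : k →+* L) (hφ : φ.Finite)
    (i : R →+* A) (hi : i.IsIntegral) (j : A →+* L) (hj : Function.Injective j)
    (h : j.comp i = φ.comp e) : i.Finite := by
  algebraize [κ, e, φ, i, φ.comp e]
  have hfin : Module.Finite R (integralClosure R L) := finite_integralClosure_of_finiteType (K := K) (k := k) hk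
  have : IsNoetherianRing R := Algebra.FiniteType.isNoetherianRing K R
  let J : A →ₐ[R] L := { j with commutes' := fun r ↦ RingHom.congr_fun h r }
  let J' : A →ₐ[R] integralClosure R L := J.codRestrict _ (fun a ↦ (show IsIntegral R a from hi a).map J)
  have hJ' : Function.Injective J'.toLinearMap := fun x y hxy ↦ hj (congrArg Subtype.val hxy)
  exact Module.Finite.of_injective J'.toLinearMap hJ'

lemma isIso_map_top {X : Scheme.{0}} (V : X.Opens) (h : V = ⊤) :
    IsIso (X.presheaf.map (homOfLE (le_top : V ≤ ⊤)).op) := by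
  subst h
  have : (homOfLE (le_top : (⊤ : X.Opens) ≤ ⊤)) = 𝟙 _ := rfl
  rw [this, op_id, CategoryTheory.Functor.map_id]
  infer_instance

lemma comp_app_eq_appLE {X Y Z : Scheme.{0}} (t : X ⟶ Y) (q : Y ⟶ Z) (b : X ⟶ Z) (hb : t ≫ q = b)
    (U : Z.Opens) (hinj : Function.Injective (t.app (q ⁻¹ᵁ U))) :
    ∃ (V : X.Opens) (e : V = b ⁻¹ᵁ U) (j : Γ(Y, q ⁻¹ᵁ U) ⟶ Γ(X, V)),
      Function.Injective j ∧ q.app U ≫ j = b.appLE U V e.le := by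
  subst hb
  refine ⟨_, rfl, t.app (q ⁻¹ᵁ U), hinj, ?_⟩
  rw [Scheme.Hom.comp_appLE, Scheme.Hom.app_eq_appLE t]
  rfl

lemma isFinite_image {K : Type} [Field K] {S T : Scheme.{0}} (sS : S ⟶ Spec (CommRingCat.of K))
    [LocallyOfFiniteType sS] (g : T ⟶ S) [IsAffineHom g] (s : S) {L : Type} [Field L]
    (φ : S.residueField s ⟶ CommRingCat.of L) (hφ : φ.hom.Finite)
    (f : Spec (CommRingCat.of L) ⟶ T) (hf : f ≫ g = Spec.map φ ≫ S.fromSpecResidueField s)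
    (hint : IsIntegralHom (f.imageι ≫ g)) : IsFinite (f.imageι ≫ g) := by
  have hfac : f.toImage ≫ (f.imageι ≫ g) = f ≫ g := by simp
  refine { toIsAffineHom := inferInstance, finite_app := fun U hU ↦ ?_ }
  have hinj : Function.Injective (f.toImage.app ((f.imageι ≫ g) ⁻¹ᵁ U)) :=
    f.toImage_app_injective ⟨g ⁻¹ᵁ U, hU.preimage g⟩
  obtain ⟨V, e, j, hj, he⟩ := comp_app_eq_appLE f.toImage (f.imageι ≫ g) (f ≫ g) hfac U hinj
  have hpt : ∀ x : Spec (CommRingCat.of L), (f ≫ g) x = s := by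
    intro x
    rw [hf, Scheme.Hom.comp_apply, Scheme.fromSpecResidueField_apply]
  by_cases hs : s ∈ U
  · have hV : V = ⊤ := by
      rw [e]
      ext x
      simpa only [TopologicalSpace.Opens.coe_top, Set.mem_univ, iff_true] using! (show (f ≫ g) x ∈ U from (hpt x).symm ▸ hs)
    have := isIso_map_top V hV
    rw [appLE_point U s hs φ (f ≫ g) hf] at he
    let w : CommRingCat.of L ⟶ _ := (Scheme.ΓSpecIso (CommRingCat.of L)).inv ≫
      (Spec (CommRingCat.of L)).presheaf.map (homOfLE (le_top : V ≤ ⊤)).op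
    have hw : IsIso w := inferInstance
    have he' : (f.imageι ≫ g).app U ≫ (j ≫ inv w) = S.evaluation U s hs ≫ φ := by
      rw [← Category.assoc, IsIso.comp_inv_eq, he]
      simp [w]
    have hlft : LocallyOfFiniteType sS := inferInstance
    have hK := sS.finiteType_appLE (isAffineOpen_top _) hU (V := U) le_top
    refine ringHom_finite_of_embeds (K := K) ((sS.appLE ⊤ U le_top).hom.comp (Scheme.ΓSpecIso (CommRingCat.of K)).inv.hom) ?_
      (S.evaluation U s hs).hom (evaluation_frac hU s hs) φ.hom hφ _
      (hint.isIntegral_app U hU) (j ≫ inv w).hom ?_ ?_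
    · exact RingHom.FiniteType.comp hK (RingHom.FiniteType.of_surjective _
        (ConcreteCategory.bijective_of_isIso (Scheme.ΓSpecIso (CommRingCat.of K)).inv).2)
    · rw [CommRingCat.hom_comp]
      exact (ConcreteCategory.bijective_of_isIso (inv w)).1.comp hj
    · exact congrArg CommRingCat.Hom.hom he'
  · have hV : V = ⊥ := by
      rw [e]
      ext x
      simpa only [TopologicalSpace.Opens.coe_bot, Set.mem_empty_iff_false, iff_false] using! (show ¬ (f ≫ g) x ∈ U from (hpt x).symm ▸ hs)
    subst hV
    have : Subsingleton Γ(f.image, (f.imageι ≫ g) ⁻¹ᵁ U) := hj.subsingleton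
    exact RingHom.Finite.of_surjective _ (fun x ↦ ⟨0, Subsingleton.elim _ _⟩)

lemma universallyClosed_image {S T S' W : Scheme.{0}} (g : T ⟶ S) [IsAffineHom g] (h : S' ⟶ T)
    [UniversallyClosed (h ≫ g)] (a : W ⟶ S') [QuasiCompact (a ≫ h)] :
    UniversallyClosed ((a ≫ h).imageι ≫ g) := by
  have hh : UniversallyClosed h := .of_comp_of_isSeparated h g
  have hsub : Set.range (a ≫ h).imageι ⊆ Set.range h := by
    have h1 : Set.range (a ≫ h).imageι = closure (Set.range (a ≫ h)) := by
      rw [← Scheme.Hom.support_ker]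
      exact Scheme.IdealSheafData.range_subschemeι _
    rw [h1]
    refine closure_minimal ?_ h.isClosedMap.isClosed_range
    rintro _ ⟨x, rfl⟩
    exact ⟨a x, rfl⟩
  have hsurj : Surjective (pullback.snd h (a ≫ h).imageι) := by
    refine ⟨fun z ↦ ?_⟩
    obtain ⟨y, hy⟩ := hsub ⟨z, rfl⟩
    obtain ⟨w, -, hw⟩ := Scheme.Pullback.exists_preimage_pullback (f := h) y z hy
    exact ⟨w, hw⟩
  have : UniversallyClosed (pullback.snd h (a ≫ h).imageι ≫ (a ≫ h).imageι ≫ g) := by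
    rw [← pullback.condition_assoc]
    infer_instance
  exact .of_comp_surjective (pullback.snd h (a ≫ h).imageι) _

lemma exists_finite_through_point {K : Type} [Field K] {S T S' : Scheme.{0}}
    (sS : S ⟶ Spec (CommRingCat.of K)) [LocallyOfFiniteType sS] (g : T ⟶ S) [IsAffineHom g]
    (h : S' ⟶ T) [IsProper (h ≫ g)] [Surjective (h ≫ g)] (s : S) :
    ∃ (Z : Scheme.{0}) (i : Z ⟶ T), IsFinite (i ≫ g) ∧ s ∈ Set.range (i ≫ g) := by
  obtain ⟨L, _, φ, a, hφ, ha⟩ := exists_finite_point (h ≫ g) s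
  have hf : (a ≫ h) ≫ g = Spec.map φ ≫ S.fromSpecResidueField s := by rw [Category.assoc, ha]
  have hqc : QuasiCompact (a ≫ h) := by
    have : QuasiCompact ((a ≫ h) ≫ g) := by rw [hf]; infer_instance
    exact .of_comp (a ≫ h) g
  have huc := universallyClosed_image g h a
  have hint : IsIntegralHom ((a ≫ h).imageι ≫ g) :=
    IsIntegralHom.iff_universallyClosed_and_isAffineHom.mpr ⟨huc, inferInstance⟩
  refine ⟨_, (a ≫ h).imageι, isFinite_image sS g s φ hφ (a ≫ h) hf hint, ?_⟩
  let x : Spec (CommRingCat.of L) := (⊥ : PrimeSpectrum L)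
  refine ⟨(a ≫ h).toImage x, ?_⟩
  rw [← Scheme.Hom.comp_apply, Scheme.Hom.toImage_imageι_assoc, hf, Scheme.Hom.comp_apply,
    Scheme.fromSpecResidueField_apply]

lemma exists_finite_through_finite_set {K : Type} [Field K] {S T S' : Scheme.{0}}
    (sS : S ⟶ Spec (CommRingCat.of K)) [LocallyOfFiniteType sS] (g : T ⟶ S) [IsAffineHom g]
    (h : S' ⟶ T) [IsProper (h ≫ g)] [Surjective (h ≫ g)] (F : Set S) (hF : F.Finite) :
    ∃ (Z : Scheme.{0}) (i : Z ⟶ T), IsFinite (i ≫ g) ∧ F ⊆ Set.range (i ≫ g) := by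
  induction F, hF using Set.Finite.induction_on with
  | empty => exact ⟨∅, Scheme.emptyTo T, inferInstance, Set.empty_subset _⟩
  | @insert s F _ _ ih =>
    obtain ⟨Z, i, hi, hF⟩ := ih
    obtain ⟨Z', i', hi', hs⟩ := exists_finite_through_point sS g h s
    have hd : coprod.desc i i' ≫ g = coprod.desc (i ≫ g) (i' ≫ g) := by
      ext1 <;> simp
    refine ⟨Z ⨿ Z', coprod.desc i i', by rw [hd]; infer_instance, ?_⟩
    rw [Set.insert_subset_iff]
    constructor
    · obtain ⟨z, rfl⟩ := hs
      exact ⟨(coprod.inr : Z' ⟶ Z ⨿ Z') z, by rw [← Scheme.Hom.comp_apply, coprod.inr_desc_assoc]⟩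
    · refine hF.trans ?_
      rintro _ ⟨z, rfl⟩
      exact ⟨(coprod.inl : Z ⟶ Z ⨿ Z') z, by rw [← Scheme.Hom.comp_apply, coprod.inl_desc_assoc]⟩

lemma exists_finite_surjective {K : Type} [Field K] {S T S' : Scheme.{0}}
    (sS : S ⟶ Spec (CommRingCat.of K)) [LocallyOfFiniteType sS] [QuasiCompact sS]
    (g : T ⟶ S) [IsAffineHom g]
    (h : S' ⟶ T) [IsProper (h ≫ g)] [Surjective (h ≫ g)] :
    ∃ (Z : Scheme.{0}) (i : Z ⟶ T), IsFinite (i ≫ g) ∧ Surjective (i ≫ g) := by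
  have h1 : IsLocallyNoetherian S := LocallyOfFiniteType.isLocallyNoetherian sS
  have h2 : CompactSpace S := (quasiCompact_iff_compactSpace (f := sS)).mp inferInstance
  have h3 : IsNoetherian S := {}
  have hfin : (irreducibleComponents S).Finite :=
    TopologicalSpace.NoetherianSpace.finite_irreducibleComponents
  have hfin' := hfin.to_subtype
  have hgen : ∀ Z ∈ irreducibleComponents S, ∃ x : S, closure {x} = Z := fun Z hZ ↦
    QuasiSober.sober hZ.1 (isClosed_of_mem_irreducibleComponents Z hZ)
  choose γ hγ using hgen
  obtain ⟨Z, i, hi, hF⟩ := exists_finite_through_finite_set sS g h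
    (Set.range fun Z : irreducibleComponents S ↦ γ Z.1 Z.2) (Set.finite_range _)
  refine ⟨Z, i, hi, ⟨fun x ↦ ?_⟩⟩
  have hcl : IsClosed (Set.range (i ≫ g)) := (i ≫ g).isClosedMap.isClosed_range
  have hx := hγ _ (irreducibleComponent_mem_irreducibleComponents x)
  have : closure {γ (irreducibleComponent x) (irreducibleComponent_mem_irreducibleComponents x)} ⊆ Set.range (i ≫ g) :=
    closure_minimal (Set.singleton_subset_iff.mpr
      (hF ⟨⟨_, irreducibleComponent_mem_irreducibleComponents x⟩, rfl⟩)) hcl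
  rw [hx] at this
  exact this mem_irreducibleComponent

/-- If a lift of `u : S ⟶ Y` along an affine morphism `π : X ⟶ Y` exists
after a proper surjective base change `p : S' ⟶ S`, then a lift exists after a finite
surjective base change `q : S'' ⟶ S`. All schemes are separated and of finite type over a
field `K`. -/
theorem lift_after_finite_surjective_of_lift_after_proper_surjective
    (K : Type) [Field K]
    (X Y S S' : Scheme)
    (sX : X ⟶ Spec (CommRingCat.of K)) (sY : Y ⟶ Spec (CommRingCat.of K))
    (sS : S ⟶ Spec (CommRingCat.of K)) (sS' : S' ⟶ Spec (CommRingCat.of K))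
    (hXsep : IsSeparated sX) (hXlft : LocallyOfFiniteType sX) (hXqc : QuasiCompact sX)
    (hYsep : IsSeparated sY) (hYlft : LocallyOfFiniteType sY) (hYqc : QuasiCompact sY)
    (hSsep : IsSeparated sS) (hSlft : LocallyOfFiniteType sS) (hSqc : QuasiCompact sS)
    (hS'sep : IsSeparated sS') (hS'lft : LocallyOfFiniteType sS') (hS'qc : QuasiCompact sS')
    (π : X ⟶ Y) (hπ : IsAffineHom π)
    (u : S ⟶ Y)
    (p : S' ⟶ S) (hp : IsProper p) (hpsurj : Surjective p)
    (u' : S' ⟶ X) (hcomm : u' ≫ π = p ≫ u) :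
    ∃ (S'' : Scheme) (sS'' : S'' ⟶ Spec (CommRingCat.of K)),
      IsSeparated sS'' ∧ LocallyOfFiniteType sS'' ∧ QuasiCompact sS'' ∧
      ∃ (q : S'' ⟶ S), IsFinite q ∧ Surjective q ∧
        ∃ (u'' : S'' ⟶ X), u'' ≫ π = q ≫ u := by
  have hlift : u' ≫ π = p ≫ u := hcomm
  let h : S' ⟶ pullback π u := pullback.lift u' p hlift
  have hh : h ≫ pullback.snd π u = p := pullback.lift_snd _ _ _
  have haff : IsAffineHom (pullback.snd π u) :=
    isAffineHom_isStableUnderBaseChange.of_isPullback (IsPullback.of_hasPullback π u) hπ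
  have : IsProper (h ≫ pullback.snd π u) := by rw [hh]; exact hp
  have : Surjective (h ≫ pullback.snd π u) := by rw [hh]; exact hpsurj
  obtain ⟨Z, i, hi, hs⟩ := exists_finite_surjective sS (pullback.snd π u) h
  refine ⟨Z, (i ≫ pullback.snd π u) ≫ sS, inferInstance, inferInstance, inferInstance,
    i ≫ pullback.snd π u, hi, hs, i ≫ pullback.fst π u, ?_⟩
  rw [Category.assoc, Category.assoc, pullback.condition]
end

section
/- Let K be an algebraically closed field, let S and C be varieties over K, let f : C → S be a proper surjective morphism, and let s_1, …, s_n : S → C (with n ≥ 1) be pairwise disjoint sections of f. Let U be the open subscheme of C complementary to the union of the images s_i(S), and assume that the restriction f|_U : U → S is an affine morphism. Then the following are equivalent: (1) there exist a variety S', a proper surjective morphism p : S' → S, and a morphism t : S' → U with f ∘ t = p; (2) there exist a variety S', a finite surjective morphism p : S' → S, and a morphism t : S' → U with f ∘ t = p; (3) there exists an irreducible closed subset T of the underlying topological space of C with T contained in U and with Krull dimension of T equal to the Krull dimension of S. -/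
open AlgebraicGeometry CategoryTheory

/-- A variety over `K`: an integral scheme, separated and of finite type over `K`
(with respect to the given structure morphism). -/
def IsVarietyOver (K : Type) [Field K] (X : Scheme)
    (sX : X ⟶ AlgebraicGeometry.Spec (CommRingCat.of K)) : Prop :=
  IsIntegral X ∧ IsSeparated sX ∧ LocallyOfFiniteType sX ∧ QuasiCompact sX

open TopologicalSpace Topology Order in
lemma dim_le_of_cover {X : Type*} [TopologicalSpace X] {ι : Type*} {Y : ι → Type*}
    [∀ i, TopologicalSpace (Y i)] (j : ∀ i, Y i → X) (hj : ∀ i, IsOpenEmbedding (j i))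
    (hc : ∀ x, ∃ i, x ∈ Set.range (j i)) (N : WithBot ℕ∞)
    (hN : ∀ i, topologicalKrullDim (Y i) ≤ N) : topologicalKrullDim X ≤ N := by
  unfold topologicalKrullDim
  rw [krullDim_eq_iSup_coheight]
  refine iSup_le fun Z => ?_
  obtain ⟨x, hx⟩ := Z.isIrreducible.nonempty
  obtain ⟨i, y, rfl⟩ := hc x
  let Z' := (IrreducibleCloseds.orderIsoOfIsOpenEmbedding (j i) (hj i)).symm ⟨Z, ⟨y, hx⟩⟩
  have h1 : IrreducibleCloseds.map (j i) (hj i).continuous Z' = Z :=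
    congrArg Subtype.val ((IrreducibleCloseds.orderIsoOfIsOpenEmbedding (j i) (hj i)).apply_symm_apply
      ⟨Z, ⟨y, hx⟩⟩)
  rw [← h1, (hj i).coheight_map]
  exact (coheight_le_krullDim Z').trans (hN i)

lemma ringDim_fin {K R : Type*} [Field K] [CommRing R] (φ : K →+* R) (h : φ.FiniteType) :
    ∃ n : ℕ, ringKrullDim R ≤ n := by
  algebraize [φ]
  obtain ⟨n, f, hf⟩ := Algebra.FiniteType.iff_quotient_mvPolynomial''.mp
    (inferInstance : Algebra.FiniteType K R)
  refine ⟨n, (ringKrullDim_le_of_surjective f.toRingHom hf).trans ?_⟩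
  rw [MvPolynomial.ringKrullDim_of_isNoetherianRing]
  simp

lemma scheme_dim_fin (K : Type) [Field K] (S : Scheme)
    (sS : S ⟶ Spec (CommRingCat.of K)) [LocallyOfFiniteType sS] [QuasiCompact sS] :
    ∃ N : ℕ, topologicalKrullDim S ≤ N := by
  have : CompactSpace S := QuasiCompact.compactSpace_of_compactSpace sS
  let 𝒰 := S.affineCover.finiteSubcover
  have key : ∀ i : 𝒰.I₀, ∃ n : ℕ, topologicalKrullDim (𝒰.X i) ≤ n := by
    intro i
    let R := Γ(𝒰.X i, ⊤)
    have : IsAffine (𝒰.X i) := by dsimp [𝒰]; infer_instance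
    let g : Spec R ⟶ Spec (CommRingCat.of K) := (𝒰.X i).isoSpec.inv ≫ 𝒰.f i ≫ sS
    have hg : LocallyOfFiniteType g := inferInstance
    rw [← Spec.map_preimage g] at hg
    have hf := (HasRingHomProperty.Spec_iff (P := @LocallyOfFiniteType)).mp hg
    obtain ⟨n, hn⟩ := ringDim_fin _ hf
    refine ⟨n, ?_⟩
    rw [IsHomeomorph.topologicalKrullDim_eq _ (𝒰.X i).isoSpec.hom.homeomorph.isHomeomorph]
    exact (PrimeSpectrum.topologicalKrullDim_eq_ringKrullDim R).trans_le hn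
  choose n hn using key
  have : Fintype 𝒰.I₀ := by dsimp [𝒰]; infer_instance
  refine ⟨∑ i, n i, dim_le_of_cover (fun i => 𝒰.f i) (fun i => (𝒰.f i).isOpenEmbedding) ?_ _ ?_⟩
  · intro x
    exact ⟨_, 𝒰.covers x⟩
  · intro i
    refine (hn i).trans ?_
    exact_mod_cast Finset.single_le_sum (f := n) (fun _ _ => Nat.zero_le _) (Finset.mem_univ i)

attribute [local instance] specializationOrder in
open Order in
lemma height_generic {X : Type*} [TopologicalSpace X] [QuasiSober X] [T0Space X]
    [IrreducibleSpace X] :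
    (height (genericPoint X) : WithBot ℕ∞) = topologicalKrullDim X := by
  unfold topologicalKrullDim
  rw [krullDim_eq_of_orderIso (irreducibleSetEquivPoints (α := X))]
  let _ : OrderTop X := { top := genericPoint X, le_top := fun x => genericPoint_specializes x }
  exact height_top_eq_krullDim

attribute [local instance] specializationOrder in
open Order in
lemma dim_finite_map {X Y : Type*} [TopologicalSpace X] [QuasiSober X] [T0Space X]
    [IrreducibleSpace X] [TopologicalSpace Y] [QuasiSober Y] [T0Space Y]
    (f : X → Y) (hf : Continuous f) (hc : IsClosedMap f)
    (hd : ∀ x x', x ⤳ x' → f x = f x' → x = x') :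
    topologicalKrullDim X = height (f (genericPoint X)) := by
  rw [← height_generic]
  congr 1
  refine height_eq_of_strictMono f ?_ ?_ _
  · intro a b hab
    refine lt_of_le_of_ne (Specializes.map (show b ⤳ a from hab.le) hf) fun h => hab.ne ?_
    exact (hd b a hab.le h.symm).symm
  · intro a b hab
    obtain ⟨a', h1, h2⟩ := hc.specializingMap (show f a ⤳ b from hab.le)
    refine ⟨a', lt_of_le_of_ne (show a ⤳ a' from h1) ?_, h2⟩
    rintro rfl
    exact hab.ne h2.symm

attribute [local instance] specializationOrder in
open Order in
/-- A closed map with discrete fibres between irreducible sober spaces, the target being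
finite-dimensional, is surjective iff the dimensions agree. -/
lemma surj_iff_dim {X Y : Type*} [TopologicalSpace X] [QuasiSober X] [T0Space X]
    [IrreducibleSpace X] [TopologicalSpace Y] [QuasiSober Y] [T0Space Y] [IrreducibleSpace Y]
    (f : X → Y) (hf : Continuous f) (hc : IsClosedMap f)
    (hd : ∀ x x', x ⤳ x' → f x = f x' → x = x') (N : ℕ) (hN : topologicalKrullDim Y ≤ N) :
    Function.Surjective f ↔ topologicalKrullDim X = topologicalKrullDim Y := by
  rw [dim_finite_map f hf hc hd, ← height_generic (X := Y)]
  have hs : Function.Surjective f ↔ f (genericPoint X) = genericPoint Y := by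
    constructor
    · intro h
      obtain ⟨x, hx⟩ := h (genericPoint Y)
      have h1 : f (genericPoint X) ⤳ genericPoint Y := hx ▸ (genericPoint_specializes x).map hf
      exact h1.antisymm (genericPoint_specializes _) |>.eq
    · intro h y
      obtain ⟨x, _, hx⟩ := hc.specializingMap
        (show f (genericPoint X) ⤳ y from h ▸ genericPoint_specializes y)
      exact ⟨x, hx⟩
  rw [hs]
  refine ⟨fun h => by rw [h], fun h => ?_⟩
  by_contra hne
  have hlt : f (genericPoint X) < genericPoint Y :=
    lt_of_le_of_ne (genericPoint_specializes (f (genericPoint X))) hne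
  rw [← height_generic] at hN
  have h3 : height (f (genericPoint X)) < ⊤ := by
    have := (WithBot.coe_inj.mp h).symm ▸ hN
    have h4 : height (f (genericPoint X)) ≤ (N : ℕ∞) := by exact_mod_cast this
    exact h4.trans_lt (ENat.natCast_lt_top N)
  exact (height_strictMono hlt h3).ne (WithBot.coe_inj.mp h)

lemma isReduced_vanishing {X : Scheme} (Z : TopologicalSpace.Closeds X) :
    IsReduced (Scheme.IdealSheafData.vanishingIdeal Z).subscheme := by
  have : ∀ i, IsReduced ((Scheme.IdealSheafData.vanishingIdeal Z).subschemeCover.openCover.X i) := by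
    intro (V : X.affineOpens)
    change IsReduced (Spec (.of <| Γ(X, V) ⧸ (Scheme.IdealSheafData.vanishingIdeal Z).ideal V))
    have h : ((Scheme.IdealSheafData.vanishingIdeal Z).ideal V).IsRadical := by
      rw [Scheme.IdealSheafData.vanishingIdeal_ideal]
      exact PrimeSpectrum.isRadical_vanishingIdeal _
    have : _root_.IsReduced (Γ(X, V) ⧸ (Scheme.IdealSheafData.vanishingIdeal Z).ideal V) :=
      (Ideal.isRadical_iff_quotient_reduced _).mp h
    have : _root_.IsReduced
      (CommRingCat.of <| Γ(X, V) ⧸ (Scheme.IdealSheafData.vanishingIdeal Z).ideal V) := this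
    infer_instance
  exact IsReduced.of_openCover _ (Scheme.IdealSheafData.vanishingIdeal Z).subschemeCover.openCover

/-- The reduced induced structure. -/
lemma exists_reduced {X : Scheme} (T : Set X) (hT : IsClosed T) (hi : IsIrreducible T) :
    ∃ (Z : Scheme) (i : Z ⟶ X), IsIntegral Z ∧ IsClosedImmersion i ∧ Set.range i = T := by
  let I := Scheme.IdealSheafData.vanishingIdeal (X := X) ⟨T, hT⟩
  have hr : Set.range I.subschemeι = T := by
    rw [I.range_subschemeι]
    exact Scheme.IdealSheafData.coe_support_vanishingIdeal _
  have hc : IsClosedImmersion I.subschemeι := inferInstance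
  refine ⟨I.subscheme, I.subschemeι, ?_, hc, hr⟩
  have : IsReduced I.subscheme := isReduced_vanishing _
  have : IrreducibleSpace I.subscheme := by
    have h2 : IrreducibleSpace (Set.range I.subschemeι) :=
      Subtype.irreducibleSpace (by rw [hr]; exact hi)
    exact (I.subschemeι.isClosedEmbedding.isEmbedding.toHomeomorph).irreducibleSpace_iff.mpr h2
  exact isIntegral_of_irreducibleSpace_of_isReduced _

lemma key_construction (K : Type) [Field K] (S C : Scheme)
    (sS : S ⟶ Spec (CommRingCat.of K)) (hS : IsVarietyOver K S sS)
    (f : C ⟶ S) [IsProper f] (U : C.Opens) [IsAffineHom (U.ι ≫ f)]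
    (T : Set C) (hT : IsClosed T) (hi : IsIrreducible T) (hTU : T ⊆ (U : Set C)) :
    ∃ (Z : Scheme) (p : Z ⟶ S), IsVarietyOver K Z (p ≫ sS) ∧ IsFinite p ∧
      (∃ t : Z ⟶ U.toScheme, t ≫ U.ι ≫ f = p) ∧ Set.range p = f '' T ∧
      (Surjective p ↔ topologicalKrullDim T = topologicalKrullDim S) := by
  obtain ⟨h1, h2, h3, h4⟩ := hS
  obtain ⟨Z, i, hZ, hci, hr⟩ := exists_reduced T hT hi
  have hle : Set.range i ⊆ Set.range U.ι := by
    rw [hr]; simpa using hTU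
  let t := IsOpenImmersion.lift U.ι i hle
  have ht : t ≫ U.ι = i := IsOpenImmersion.lift_fac _ _ _
  have htc : IsClosedImmersion t := by
    have : IsClosedImmersion (t ≫ U.ι) := ht ▸ hci
    exact IsClosedImmersion.of_comp t U.ι
  have hp : t ≫ U.ι ≫ f = i ≫ f := by rw [← Category.assoc, ht]
  have haff : IsAffineHom (i ≫ f) := by rw [← hp]; infer_instance
  have hfin : IsFinite (i ≫ f) := (IsFinite.iff_isProper_and_isAffineHom).mpr ⟨inferInstance, haff⟩
  refine ⟨Z, i ≫ f, ⟨hZ, inferInstance, inferInstance, inferInstance⟩, hfin, ⟨t, hp⟩, ?_, ?_⟩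
  · rw [← hr, ← Set.range_comp]; simp
  · obtain ⟨N, hN⟩ := scheme_dim_fin K S sS
    have hdT : topologicalKrullDim T = topologicalKrullDim Z := by
      subst hr
      exact ((i.isClosedEmbedding.isEmbedding.toHomeomorph).isHomeomorph.topologicalKrullDim_eq).symm
    rw [hdT, surjective_iff]
    refine surj_iff_dim (i ≫ f) (i ≫ f).continuous (i ≫ f).isClosedMap ?_ N hN
    intro x x' hx he
    exact ((i ≫ f).isDiscrete_preimage_singleton ((i ≫ f) x')).eq_of_specializes hx he rfl

/-- Equivalent formulations of the weak Lifting Conjecture for a family of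
pointed curves: existence of a lift after a proper surjective base change, after a finite
surjective base change, and existence of an irreducible closed subset of the total space
avoiding the sections and of the same dimension as the base. -/
theorem weak_lifting_equivalences
    (K : Type) [Field K] [IsAlgClosed K]
    (S C : Scheme)
    (sS : S ⟶ Spec (CommRingCat.of K)) (sC : C ⟶ Spec (CommRingCat.of K))
    (hS : IsVarietyOver K S sS) (hC : IsVarietyOver K C sC)
    (f : C ⟶ S) (hfprop : IsProper f) (hfsurj : Surjective f)
    (n : ℕ) (hn : 1 ≤ n)
    (s : Fin n → (S ⟶ C)) (hsec : ∀ i, s i ≫ f = 𝟙 S)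
    (hdisj : ∀ i j, i ≠ j → Disjoint (Set.range (s i).base) (Set.range (s j).base))
    (U : C.Opens) (hU : (U : Set C) = (⋃ i, Set.range (s i).base)ᶜ)
    (hUaff : IsAffineHom (U.ι ≫ f)) :
    ((∃ (S' : Scheme) (p : S' ⟶ S), IsVarietyOver K S' (p ≫ sS) ∧
        IsProper p ∧ Surjective p ∧
        ∃ t : S' ⟶ U.toScheme, t ≫ U.ι ≫ f = p) ↔
      (∃ (S' : Scheme) (p : S' ⟶ S), IsVarietyOver K S' (p ≫ sS) ∧
        IsFinite p ∧ Surjective p ∧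
        ∃ t : S' ⟶ U.toScheme, t ≫ U.ι ≫ f = p)) ∧
    ((∃ (S' : Scheme) (p : S' ⟶ S), IsVarietyOver K S' (p ≫ sS) ∧
        IsFinite p ∧ Surjective p ∧
        ∃ t : S' ⟶ U.toScheme, t ≫ U.ι ≫ f = p) ↔
      (∃ T : Set C, IsIrreducible T ∧ IsClosed T ∧ T ⊆ (U : Set C) ∧
        topologicalKrullDim T = topologicalKrullDim S)) := by
  have h12 : ∀ (S' : Scheme) (p : S' ⟶ S), IsVarietyOver K S' (p ≫ sS) → IsProper p →
      Surjective p → ∀ t : S' ⟶ U.toScheme, t ≫ U.ι ≫ f = p →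
      ∃ T : Set C, IsIrreducible T ∧ IsClosed T ∧ T ⊆ (U : Set C) ∧ f '' T = Set.univ := by
    intro S' p hS' hp hps t ht
    have hintegral := hS'.1
    have hprop : IsProper (t ≫ U.ι) := by
      have : IsProper ((t ≫ U.ι) ≫ f) := by rw [Category.assoc, ht]; exact hp
      exact IsProper.of_comp (t ≫ U.ι) f
    refine ⟨Set.range (t ≫ U.ι), ?_, (t ≫ U.ι).isClosedMap.isClosed_range, ?_, ?_⟩
    · rw [← Set.image_univ]
      exact (IrreducibleSpace.isIrreducible_univ S').image _ (t ≫ U.ι).continuous.continuousOn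
    · rintro _ ⟨x, rfl⟩
      rw [Scheme.Hom.comp_apply]
      exact (t x).2
    · refine Set.eq_univ_of_forall fun y => ?_
      obtain ⟨x, hx⟩ := p.surjective y
      refine ⟨(t ≫ U.ι) x, ⟨x, rfl⟩, ?_⟩
      rw [← Scheme.Hom.comp_apply, Category.assoc, ht, hx]
  have hsurj : ∀ (T : Set C) (Z : Scheme) (p : Z ⟶ S), Set.range p = f '' T →
      f '' T = Set.univ → Surjective p := fun T Z p h1 h2 =>
    ⟨Set.range_eq_univ.mp (h1.trans h2)⟩
  refine ⟨⟨?_, ?_⟩, ?_, ?_⟩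
  · rintro ⟨S', p, hS', hp, hps, t, ht⟩
    obtain ⟨T, hTi, hTc, hTU, hT⟩ := h12 S' p hS' hp hps t ht
    obtain ⟨Z, q, hZ, hq, hl, hr, -⟩ := key_construction K S C sS hS f U T hTc hTi hTU
    exact ⟨Z, q, hZ, hq, hsurj T Z q hr hT, hl⟩
  · rintro ⟨S', p, hS', hp, hps, h⟩
    exact ⟨S', p, hS', inferInstance, hps, h⟩
  · rintro ⟨S', p, hS', hp, hps, t, ht⟩
    obtain ⟨T, hTi, hTc, hTU, hT⟩ := h12 S' p hS' inferInstance hps t ht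
    obtain ⟨Z, q, hZ, hq, hl, hr, hd⟩ := key_construction K S C sS hS f U T hTc hTi hTU
    exact ⟨T, hTi, hTc, hTU, hd.mp (hsurj T Z q hr hT)⟩
  · rintro ⟨T, hTi, hTc, hTU, hT⟩
    obtain ⟨Z, q, hZ, hq, hl, hr, hd⟩ := key_construction K S C sS hS f U T hTc hTi hTU
    exact ⟨Z, q, hZ, hq, hd.mpr hT, hl⟩
end

section
/- Let K be an algebraically closed field, let S and C be varieties over K, let f : C → S be a proper surjective morphism, and let s_1, …, s_n : S → C (with n ≥ 1) be pairwise disjoint sections of f. Let U be the open subscheme of C complementary to the union of the images s_i(S), assume that the restriction f|_U : U → S is an affine morphism, and let x be a closed point of C lying in U. Then the following are equivalent: (1) there exist a variety S', a proper surjective morphism p : S' → S, and a morphism t : S' → U with f ∘ t = p and x ∈ t(S'); (2) there exist a variety S', a finite surjective morphism p : S' → S, and a morphism t : S' → U with f ∘ t = p and x ∈ t(S'); (3) there exists an irreducible closed subset T of the underlying topological space of C with x ∈ T, T contained in U, and Krull dimension of T equal to the Krull dimension of S. -/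
open AlgebraicGeometry CategoryTheory

theorem exists_integral_closed {X : Scheme} [QuasiSeparatedSpace X] (T : Set X)
    (hT : IsIrreducible T) (hTc : IsClosed T) :
    ∃ (Z : Scheme) (i : Z ⟶ X), IsIntegral Z ∧ IsClosedImmersion i ∧ Set.range i = T := by
  obtain ⟨η, hη⟩ := QuasiSober.sober hT hTc
  let g := X.fromSpecResidueField η
  have hq : QuasiCompact g := inferInstance
  refine ⟨g.image, g.imageι, ?_, inferInstance, ?_⟩
  · have : IsReduced g.image := by
      have (U : X.affineOpens) :
          IsReduced (g.ker.subschemeCover.openCover.X U) := by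
        have h1 : _root_.IsReduced (Γ(X, U.1) ⧸ g.ker.ideal U) := by
          rw [g.ker_apply]
          exact isReduced_of_injective _ (RingHom.kerLift_injective (g.app U.1).hom)
        exact inferInstanceAs (IsReduced (Spec (.of (Γ(X, U.1) ⧸ g.ker.ideal U))))
      have : ∀ U, IsReduced (g.ker.subschemeCover.openCover.X U) := this
      exact IsReduced.of_openCover _ g.ker.subschemeCover.openCover
    have : IrreducibleSpace g.image := by
      have h1 := g.toImage.denseRange
      rw [irreducibleSpace_def, Set.top_eq_univ, ← h1.closure_range, ← Set.image_univ]
      exact ((IrreducibleSpace.isIrreducible_univ _).image _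
        g.toImage.continuous.continuousOn).closure
    exact isIntegral_of_irreducibleSpace_of_isReduced _
  · rw [Scheme.IdealSheafData.range_subschemeι, Scheme.Hom.support_ker, Scheme.range_fromSpecResidueField]
    exact hη

attribute [local instance] specializationOrder in
theorem height_eq_of_closed {X Y : Type*} [TopologicalSpace X] [TopologicalSpace Y]
    [T0Space X] [T0Space Y] (g : X → Y) (hg : Continuous g) (hc : IsClosedMap g)
    (hd : ∀ y, _root_.IsDiscrete (g ⁻¹' {y})) (x : X) : Order.height x = Order.height (g x) := by
  apply Order.height_eq_of_strictMono
  · intro a b hab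
    have hs : b ⤳ a := hab.le
    refine lt_of_le_of_ne (hs.map hg) ?_
    intro he
    apply hab.ne
    have := (hd (g b)).to_subtype
    have h2 : (⟨b, rfl⟩ : g ⁻¹' {g b}) ⤳ ⟨a, he⟩ := by
      rwa [subtype_specializes_iff]
    exact (congrArg Subtype.val h2.eq).symm
  · intro a b hb
    obtain ⟨a', h1, h2⟩ := hc.specializingMap (show g a ⤳ b from hb.le)
    exact ⟨a', lt_of_le_of_ne h1 (by rintro rfl; exact hb.ne h2.symm), h2⟩

attribute [local instance] specializationOrder in
theorem topDim_eq_height {X : Type*} [TopologicalSpace X] [T0Space X] [QuasiSober X]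
    [IrreducibleSpace X] : topologicalKrullDim X = Order.height (genericPoint X) := by
  rw [topologicalKrullDim, Order.krullDim_eq_of_orderIso (irreducibleSetEquivPoints (α := X))]
  let : OrderTop X := { top := genericPoint X, le_top := fun a => genericPoint_specializes a }
  exact Order.height_top_eq_krullDim.symm

theorem ringKrullDim_lt_top_of_finiteType {K A : Type*} [Field K] [CommRing A] [Algebra K A]
   [Algebra.FiniteType K A] : ringKrullDim A < ⊤ := by
  obtain ⟨n, f, hf⟩ := Algebra.FiniteType.iff_quotient_mvPolynomial''.mp ‹Algebra.FiniteType K A›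
  refine (ringKrullDim_le_of_surjective f.toRingHom hf).trans_lt ?_
  rw [MvPolynomial.ringKrullDim_of_isNoetherianRing, ringKrullDim_eq_zero_of_field]
  simp
  exact compareOfLessAndEq_eq_lt.mp rfl

attribute [local instance] specializationOrder in
theorem coheight_le_topDim {X : Type*} [TopologicalSpace X] [T0Space X] [QuasiSober X]
    (a : X) : (Order.coheight a : WithBot ℕ∞) ≤ topologicalKrullDim X := by
  rw [topologicalKrullDim, Order.krullDim_eq_of_orderIso (irreducibleSetEquivPoints (α := X))]
  exact Order.coheight_le_krullDim _

attribute [local instance] specializationOrder in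
theorem topDim_lt_top_of_cover {X : Type*} [TopologicalSpace X] [T0Space X] [QuasiSober X]
    (s : Set (TopologicalSpace.Opens X)) (hs : s.Finite) (hc : ∀ a : X, ∃ V ∈ s, a ∈ V)
    (hV : ∀ V ∈ s, topologicalKrullDim V < ⊤) : topologicalKrullDim X < ⊤ := by
  rw [topologicalKrullDim, Order.krullDim_eq_of_orderIso (irreducibleSetEquivPoints (α := X)),
    Order.krullDim_eq_iSup_coheight]
  have hle : (⨆ a : X, (Order.coheight a : WithBot ℕ∞)) ≤
      hs.toFinset.sup fun V => topologicalKrullDim V := by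
    refine iSup_le fun a => ?_
    obtain ⟨V, hVs, haV⟩ := hc a
    refine le_trans ?_ (Finset.le_sup (hs.mem_toFinset.mpr hVs))
    have : QuasiSober V := V.isOpen.isOpenEmbedding_subtypeVal.quasiSober
    have h1 := V.isOpen.isOpenEmbedding_subtypeVal.coheight_eq (x := ⟨a, haV⟩) Subtype.val
    change Order.coheight a = _ at h1
    rw [h1]
    exact coheight_le_topDim _
  refine hle.trans_lt ?_
  rw [Finset.sup_lt_iff (WithBot.bot_lt_coe _)]
  exact fun V h => hV V (hs.mem_toFinset.mp h)

theorem topDim_lt_top {K : Type} [Field K] {S : Scheme} (sS : S ⟶ Spec (CommRingCat.of K))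
    [LocallyOfFiniteType sS] [CompactSpace S] : topologicalKrullDim S < ⊤ := by
  have hV : ∀ V : S.affineOpens, topologicalKrullDim V.1 < ⊤ := by
    intro V
    have := IsHomeomorph.topologicalKrullDim_eq _ V.2.isoSpec.hom.homeomorph.isHomeomorph
    change topologicalKrullDim V.1.toScheme < ⊤
    rw [this]
    change topologicalKrullDim (PrimeSpectrum Γ(S, V)) < ⊤
    rw [PrimeSpectrum.topologicalKrullDim_eq_ringKrullDim]
    have h := sS.finiteType_appLE (isAffineOpen_top _) V.2 le_top
    let φ : K →+* Γ(S, V) := (sS.appLE ⊤ V.1 le_top).hom.comp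
      (Scheme.ΓSpecIso (CommRingCat.of K)).inv.hom
    have hφ : φ.FiniteType := h.comp (RingHom.FiniteType.of_surjective _
      (Scheme.ΓSpecIso (CommRingCat.of K)).symm.commRingCatIsoToRingEquiv.surjective)
    algebraize [φ]
    exact ringKrullDim_lt_top_of_finiteType (K := K)
  obtain ⟨s, hs, hs'⟩ := isCompact_iff_finite_and_eq_biUnion_affineOpens.mp
    (show IsCompact ((⊤ : S.Opens) : Set S) from isCompact_univ)
  refine topDim_lt_top_of_cover (Subtype.val '' s) (hs.image _) ?_ ?_
  · intro a
    have ha : a ∈ (⊤ : S.Opens) := trivial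
    rw [hs'] at ha
    simp only [TopologicalSpace.Opens.mem_iSup] at ha
    obtain ⟨V, hVs, haV⟩ := ha
    exact ⟨V.1, ⟨V, hVs, rfl⟩, haV⟩
  · rintro _ ⟨V, -, rfl⟩
    exact hV V

/-- finite surjective morphisms preserve dimension -/
theorem topDim_eq_of_finite_surjective {X Y : Scheme} (g : X ⟶ Y) [IsFinite g] [Surjective g]
    [IsIntegral X] [IsIntegral Y] : topologicalKrullDim X = topologicalKrullDim Y := by
  rw [topDim_eq_height, topDim_eq_height, height_eq_of_closed g g.continuous g.isClosedMap
    g.isDiscrete_preimage_singleton]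
  congr 2
  have := (genericPoint_spec X).image g.continuous
  rw [Set.image_univ, g.surjective.range_eq, closure_univ] at this
  exact this.eq (genericPoint_spec Y)

theorem surjective_of_finite_of_topDim {K : Type} [Field K] {X Y : Scheme} (g : X ⟶ Y) [IsFinite g]
    [IsIntegral X] [IsIntegral Y] (sY : Y ⟶ Spec (CommRingCat.of K))
    [LocallyOfFiniteType sY] [CompactSpace Y]
    (h : topologicalKrullDim X = topologicalKrullDim Y) : Surjective g := by
  have hfin := topDim_lt_top sY
  rw [topDim_eq_height, topDim_eq_height, height_eq_of_closed g g.continuous g.isClosedMap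
    g.isDiscrete_preimage_singleton] at h
  rw [topDim_eq_height] at hfin
  have heq : g (genericPoint X) = genericPoint Y := by
    by_contra hne
    let := specializationOrder Y
    have hlt : g (genericPoint X) < genericPoint Y :=
      lt_of_le_of_ne (genericPoint_specializes _) hne
    have h1 := WithBot.coe_injective h
    have := Order.height_strictMono hlt (h1 ▸ WithBot.coe_lt_coe.mp hfin)
    exact this.ne h1
  have h1 := (genericPoint_spec X).image g.continuous
  rw [heq, Set.image_univ] at h1
  have h2 := h1.symm.trans (genericPoint_spec Y)
  rw [g.isClosedMap.isClosed_range.closure_eq] at h2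
  exact ⟨Set.range_eq_univ.mp h2⟩

/-- Main construction. -/
theorem finite_of_closed {K : Type} [Field K] {S C : Scheme} (sS : S ⟶ Spec (CommRingCat.of K))
    (hS : IsVarietyOver K S sS) (f : C ⟶ S) (hfprop : IsProper f)
    (U : C.Opens) (hUaff : IsAffineHom (U.ι ≫ f)) (T : Set C) (hT : IsIrreducible T)
    (hTc : IsClosed T) (hTU : T ⊆ U) :
    ∃ (S' : Scheme) (p : S' ⟶ S), IsVarietyOver K S' (p ≫ sS) ∧ IsFinite p ∧
      Set.range p = f '' T ∧
      topologicalKrullDim S' = topologicalKrullDim T ∧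
      ∃ t : S' ⟶ U.toScheme, t ≫ U.ι ≫ f = p ∧ Set.range (t ≫ U.ι).base = T := by
  obtain ⟨h1, h2, h3, h4⟩ := hS
  have : QuasiSeparatedSpace C := by
    exact (quasiSeparated_iff_quasiSeparatedSpace (f ≫ sS)).mp inferInstance
  obtain ⟨Z, i, hZ, hi, hr⟩ := exists_integral_closed T hT hTc
  have hsub : Set.range i ⊆ Set.range U.ι := by
    rw [hr, Scheme.Opens.range_ι]; exact hTU
  let t := IsOpenImmersion.lift U.ι i hsub
  have ht : t ≫ U.ι = i := IsOpenImmersion.lift_fac _ _ _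
  have hti : IsClosedImmersion (t ≫ U.ι) := ht ▸ hi
  have : IsClosedImmersion t := IsClosedImmersion.of_comp t U.ι
  have hfin : IsFinite (i ≫ f) := by
    rw [IsFinite.iff_isProper_and_isAffineHom]
    refine ⟨inferInstance, ?_⟩
    rw [← ht, Category.assoc]
    infer_instance
  refine ⟨Z, i ≫ f, ⟨hZ, inferInstance, inferInstance, inferInstance⟩, hfin, ?_, ?_, t, ?_, ?_⟩
  · rw [← hr, ← Set.range_comp]; simp
  · have := i.isEmbedding.toHomeomorph.isHomeomorph.topologicalKrullDim_eq
    rw [this, hr]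
  · rw [← ht, Category.assoc]
  · rw [ht]; exact hr

theorem strong_lifting_equivalences
    (K : Type) [Field K] [IsAlgClosed K]
    (S C : Scheme)
    (sS : S ⟶ Spec (CommRingCat.of K)) (sC : C ⟶ Spec (CommRingCat.of K))
    (hS : IsVarietyOver K S sS) (hC : IsVarietyOver K C sC)
    (f : C ⟶ S) (hfprop : IsProper f) (hfsurj : Surjective f)
    (n : ℕ) (hn : 1 ≤ n)
    (s : Fin n → (S ⟶ C)) (hsec : ∀ i, s i ≫ f = 𝟙 S)
    (hdisj : ∀ i j, i ≠ j → Disjoint (Set.range (s i).base) (Set.range (s j).base))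
    (U : C.Opens) (hU : (U : Set C) = (⋃ i, Set.range (s i).base)ᶜ)
    (hUaff : IsAffineHom (U.ι ≫ f))
    (x : C) (hxclosed : IsClosed ({x} : Set C)) (hxU : x ∈ U) :
    ((∃ (S' : Scheme) (p : S' ⟶ S), IsVarietyOver K S' (p ≫ sS) ∧
        IsProper p ∧ Surjective p ∧
        ∃ t : S' ⟶ U.toScheme, t ≫ U.ι ≫ f = p ∧ x ∈ Set.range (t ≫ U.ι).base) ↔
      (∃ (S' : Scheme) (p : S' ⟶ S), IsVarietyOver K S' (p ≫ sS) ∧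
        IsFinite p ∧ Surjective p ∧
        ∃ t : S' ⟶ U.toScheme, t ≫ U.ι ≫ f = p ∧ x ∈ Set.range (t ≫ U.ι).base)) ∧
    ((∃ (S' : Scheme) (p : S' ⟶ S), IsVarietyOver K S' (p ≫ sS) ∧
        IsFinite p ∧ Surjective p ∧
        ∃ t : S' ⟶ U.toScheme, t ≫ U.ι ≫ f = p ∧ x ∈ Set.range (t ≫ U.ι).base) ↔
      (∃ T : Set C, x ∈ T ∧ IsIrreducible T ∧ IsClosed T ∧ T ⊆ (U : Set C) ∧
        topologicalKrullDim T = topologicalKrullDim S)) := by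
  have key : ∀ (S' : Scheme) (p : S' ⟶ S), IsVarietyOver K S' (p ≫ sS) →
      IsProper p → Surjective p →
      ∀ t : S' ⟶ U.toScheme, t ≫ U.ι ≫ f = p → x ∈ Set.range (t ≫ U.ι).base →
      ∃ T : Set C, x ∈ T ∧ IsIrreducible T ∧ IsClosed T ∧ T ⊆ (U : Set C) ∧ f '' T = Set.univ := by
    intro S' p hS' hp hps t ht hx
    have := hS'.1
    have hpr : IsProper ((t ≫ U.ι) ≫ f) := by rwa [Category.assoc, ht]
    have hpr' : IsProper (t ≫ U.ι) := IsProper.of_comp _ f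
    refine ⟨Set.range (t ≫ U.ι), hx, ?_, (t ≫ U.ι).isClosedMap.isClosed_range, ?_, ?_⟩
    · rw [← Set.image_univ]
      exact (IrreducibleSpace.isIrreducible_univ _).image _ (t ≫ U.ι).continuous.continuousOn
    · rintro _ ⟨y, rfl⟩
      rw [Scheme.Hom.comp_apply]
      exact (t y).2
    · have h := p.surjective.range_eq
      rw [← ht, ← Category.assoc] at h
      rw [← h, ← Set.range_comp]
      simp only [Scheme.Hom.comp_apply, Function.comp_def]
      congr 1
  have hS1 := hS.1
  refine ⟨⟨?_, ?_⟩, ⟨?_, ?_⟩⟩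
  · rintro ⟨S', p, hS', hp, hps, t, ht, hx⟩
    obtain ⟨T, hxT, hT, hTc, hTU, hTs⟩ := key S' p hS' hp hps t ht hx
    obtain ⟨Z, q, hZ, hq, hqr, -, u, hu, hur⟩ :=
      finite_of_closed sS hS f hfprop U hUaff T hT hTc hTU
    exact ⟨Z, q, hZ, hq, ⟨Set.range_eq_univ.mp (hqr.trans hTs)⟩, u, hu, hur ▸ hxT⟩
  · rintro ⟨S', p, hS', hp, hps, t, ht, hx⟩
    exact ⟨S', p, hS', inferInstance, hps, t, ht, hx⟩
  · rintro ⟨S', p, hS', hp, hps, t, ht, hx⟩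
    obtain ⟨T, hxT, hT, hTc, hTU, hTs⟩ := key S' p hS' inferInstance hps t ht hx
    obtain ⟨Z, q, hZ, hq, hqr, hdim, u, hu, hur⟩ :=
      finite_of_closed sS hS f hfprop U hUaff T hT hTc hTU
    have : Surjective q := ⟨Set.range_eq_univ.mp (hqr.trans hTs)⟩
    have := hZ.1
    exact ⟨T, hxT, hT, hTc, hTU, hdim.symm.trans (topDim_eq_of_finite_surjective q)⟩
  · rintro ⟨T, hxT, hT, hTc, hTU, hTd⟩
    obtain ⟨Z, q, hZ, hq, hqr, hdim, u, hu, hur⟩ :=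
      finite_of_closed sS hS f hfprop U hUaff T hT hTc hTU
    have := hZ.1
    have := hS.2.2.1
    have := hS.2.2.2
    have : CompactSpace S := QuasiCompact.compactSpace_of_compactSpace sS
    exact ⟨Z, q, hZ, hq, surjective_of_finite_of_topDim q sS (hdim.trans hTd), u, hu, hur ▸ hxT⟩
end

section
/- Let K be an algebraically closed field, let S be a variety over K, let n ≥ 3 be an integer, and let r_1, …, r_n : S → ℙ¹_K be morphisms whose graphs Γ_i ⊆ S ×_K ℙ¹_K (the images of the closed immersions (id_S, r_i) : S → S ×_K ℙ¹_K) are pairwise disjoint. Then for every closed point z of S ×_K ℙ¹_K not lying on any Γ_i, there exists a closed subset T of the underlying space of S ×_K ℙ¹_K such that z ∈ T, T ∩ Γ_i = ∅ for all i, and the first projection, restricted to T with its reduced induced closed subscheme structure, is a finite surjective morphism T → S. -/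
open AlgebraicGeometry CategoryTheory CategoryTheory.Limits

attribute [local instance] MvPolynomial.gradedAlgebra

/-- The projective line `ℙ¹_K` over `K`, as `Proj K[X₀, X₁]`. -/
noncomputable def ProjLine (K : Type) [Field K] : Scheme :=
  Proj (MvPolynomial.homogeneousSubmodule (Fin 2) K)

/-- The structure morphism `ℙ¹_K ⟶ Spec K`. -/
noncomputable def ProjLine.structMap (K : Type) [Field K] :
    ProjLine K ⟶ Spec (CommRingCat.of K) :=
  Proj.toSpecZero (MvPolynomial.homogeneousSubmodule (Fin 2) K) ≫
    Spec.map (CommRingCat.ofHom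
      (algebraMap K ↥(MvPolynomial.homogeneousSubmodule (Fin 2) K 0)))

/-- The graph `Γ ⊆ S ×_K ℙ¹_K` of a `K`-morphism `r : S ⟶ ℙ¹_K`, i.e. the set-theoretic
image of the closed immersion `(id_S, r) : S ⟶ S ×_K ℙ¹_K`. -/
noncomputable def graphSet (K : Type) [Field K] (S : Scheme)
    (sS : S ⟶ Spec (CommRingCat.of K)) (r : S ⟶ ProjLine K)
    (h : r ≫ ProjLine.structMap K = sS) :
    Set ↥(pullback sS (ProjLine.structMap K)) :=
  Set.range (pullback.lift (𝟙 S) r (by rw [Category.id_comp, h])).base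

section GZAlg

def gzBr {R : Type*} [CommRing R] (x y : Fin 2 → R) : R := x 0 * y 1 - x 1 * y 0

noncomputable def gzF {R : Type*} [CommRing R] {m : ℕ} (l : Fin m → R) (v : Fin m → Fin 2 → R)
    (w x : Fin 2 → R) : R :=
  ∑ i, l i * gzBr (v i) w * ∏ j ∈ Finset.univ.erase i, gzBr x (v j)

lemma gzBr_map {R R' : Type*} [CommRing R] [CommRing R'] (φ : R →+* R') (x y : Fin 2 → R) :
    gzBr (φ ∘ x) (φ ∘ y) = φ (gzBr x y) := by simp [gzBr]

lemma gzF_map {R R' : Type*} [CommRing R] [CommRing R'] (φ : R →+* R') {m : ℕ} (l : Fin m → R)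
    (v : Fin m → Fin 2 → R) (w x : Fin 2 → R) :
    gzF (φ ∘ l) (fun i => φ ∘ v i) (φ ∘ w) (φ ∘ x) = φ (gzF l v w x) := by
  simp [gzF, gzBr]

lemma gzF_smul {R : Type*} [CommRing R] {m : ℕ} (l : Fin m → R) (v v' : Fin m → Fin 2 → R)
    (w x w' x' : Fin 2 → R) (c : Fin m → R) (d e : R) (hv : ∀ i j, v i j = c i * v' i j)
    (hw : ∀ j, w j = d * w' j) (hx : ∀ j, x j = e * x' j) :
    gzF l v w x = ((∏ i, c i) * d * e ^ (m - 1)) * gzF l v' w' x' := by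
  rw [gzF, gzF, Finset.mul_sum]
  refine Finset.sum_congr rfl fun i _ => ?_
  have h1 : ∀ j, gzBr x (v j) = (e * c j) * gzBr x' (v' j) := by
    intro j; simp only [gzBr, hv, hx]; ring
  have h2 : gzBr (v i) w = (c i * d) * gzBr (v' i) w' := by
    simp only [gzBr, hv, hw]; ring
  simp only [h1, h2, Finset.prod_mul_distrib, Finset.prod_const]
  rw [← Finset.mul_prod_erase _ _ (Finset.mem_univ i), Finset.card_erase_of_mem (Finset.mem_univ i)]
  simp only [Finset.card_univ, Fintype.card_fin]
  ring

lemma gzF_at {R : Type*} [Field R] {m : ℕ} (l : Fin m → R) (v : Fin m → Fin 2 → R)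
    (w : Fin 2 → R) (hl : ∀ i, l i ≠ 0) (hvw : ∀ i, gzBr (v i) w ≠ 0)
    (hv : ∀ i j, i ≠ j → gzBr (v i) (v j) ≠ 0) (i : Fin m) : gzF l v w (v i) ≠ 0 := by
  rw [gzF, Finset.sum_eq_single i]
  · refine mul_ne_zero (mul_ne_zero (hl i) (hvw i)) (Finset.prod_ne_zero_iff.mpr fun j hj => ?_)
    exact hv _ _ (Finset.ne_of_mem_erase hj).symm
  · intro j _ hj
    rw [Finset.prod_eq_zero (i := i)]
    · simp
    · simp [hj.symm]
    · simp [gzBr]; ring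
  · simp

lemma gzF_last {R : Type*} [Field R] {m : ℕ} (l : Fin m → R) (v : Fin m → Fin 2 → R)
    (w : Fin 2 → R) (hl : ∑ i, l i ≠ 0) (hvw : ∀ i, gzBr (v i) w ≠ 0) : gzF l v w w ≠ 0 := by
  have : gzF l v w w = -(∑ i, l i) * ∏ j, gzBr w (v j) := by
    rw [gzF, ← Finset.sum_neg_distrib, Finset.sum_mul]
    refine Finset.sum_congr rfl fun i _ => ?_
    rw [← Finset.mul_prod_erase _ _ (Finset.mem_univ i)]
    simp only [gzBr]; ring
  rw [this]
  refine mul_ne_zero (neg_ne_zero.mpr hl) (Finset.prod_ne_zero_iff.mpr fun j _ h => hvw j ?_)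
  simp only [gzBr] at h ⊢; linear_combination -h

lemma gz_exists_pt {K L : Type*} [Field K] [Field L] [Infinite K] (φ : K →+* L) {m : ℕ}
    (l : Fin m → L) (v : Fin m → Fin 2 → L) (w x : Fin 2 → L) (h : gzF l v w x ≠ 0) :
    ∃ a : Fin 2 → K, gzF l v w (φ ∘ a) ≠ 0 := by
  by_contra! hc
  let P : MvPolynomial (Fin 2) L :=
    gzF (MvPolynomial.C ∘ l) (fun i => MvPolynomial.C ∘ v i) (MvPolynomial.C ∘ w) MvPolynomial.X
  have hP : ∀ y, MvPolynomial.eval y P = gzF l v w y := by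
    intro y
    rw [← gzF_map]
    congr 1 <;> ext <;> simp
  have : P = 0 := by
    refine MvPolynomial.funext_set (fun _ => Set.range φ)
      (fun _ => Set.infinite_range_of_injective φ.injective) ?_
    intro y hy
    choose a ha using fun i => hy i (Set.mem_univ _)
    have : y = φ ∘ a := by ext i; simp [ha]
    rw [hP, this, hc]; simp
  exact h (by rw [← hP, this]; simp)

lemma gz_exists_root {L : Type*} [Field L] [IsAlgClosed L] {m : ℕ} (hm : 2 ≤ m)
    (l : Fin m → L) (v : Fin m → Fin 2 → L) (w : Fin 2 → L) :
    ∃ x : Fin 2 → L, x ≠ 0 ∧ gzF l v w x = 0 := by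
  by_cases h : gzF l v w ![0, 1] = 0
  · exact ⟨_, fun h => by simpa using congrFun h 1, h⟩
  let P : Polynomial L :=
    gzF (Polynomial.C ∘ l) (fun i => Polynomial.C ∘ v i) (Polynomial.C ∘ w) ![1, Polynomial.X]
  have hP : ∀ y, Polynomial.eval y P = gzF l v w ![1, y] := by
    intro y
    rw [← Polynomial.coe_evalRingHom, ← gzF_map]
    congr 1
    · ext; simp
    · ext; simp
    · ext; simp
    · ext i; fin_cases i <;> simp
  have hc : P.coeff (m - 1) = gzF l v w ![0, 1] := by
    simp only [P, gzF, Polynomial.finsetSum_coeff]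
    refine Finset.sum_congr rfl fun i _ => ?_
    have : (Polynomial.C ∘ l) i * gzBr (Polynomial.C ∘ v i) (Polynomial.C ∘ w) =
      Polynomial.C (l i * gzBr (v i) w) := by simp [gzBr]
    rw [this, Polynomial.coeff_C_mul]
    congr 1
    have hcard : m - 1 = (Finset.univ.erase i).card * 1 := by simp
    rw [hcard, Polynomial.coeff_prod_of_natDegree_le]
    · refine Finset.prod_congr rfl fun j _ => ?_
      simp [gzBr, Polynomial.coeff_C]
    · intro j _
      simp only [gzBr]
      simp only [Matrix.cons_val_zero, Matrix.cons_val_one, Function.comp, one_mul]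
      compute_degree
  obtain ⟨y, hy⟩ := IsAlgClosed.exists_root P (by
    intro h0
    have : P.natDegree = 0 := Polynomial.natDegree_eq_of_degree_eq_some h0
    have h2 := Polynomial.le_natDegree_of_ne_zero (hc ▸ h)
    omega)
  exact ⟨![1, y], fun h => by simpa using congrFun h 0, by rw [← hP]; exact hy⟩

lemma gz_exists_lam {K : Type*} [Field K] [Infinite K] {m : ℕ} (hm : 2 ≤ m)
    (v : Fin m → Fin 2 → K) (w x : Fin 2 → K)
    (hvw : ∀ i, gzBr (v i) w ≠ 0) (hv : ∀ i j, i ≠ j → gzBr (v i) (v j) ≠ 0)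
    (hxw : gzBr x w ≠ 0) (hx : ∀ i, gzBr x (v i) ≠ 0) :
    ∃ l : Fin m → K, (∀ i, l i ≠ 0) ∧ ∑ i, l i ≠ 0 ∧ gzF l v w x = 0 := by
  classical
  let u : Fin m → K := fun i => gzBr (v i) w / gzBr x (v i)
  have hu : ∀ i, u i ≠ 0 := fun i => div_ne_zero (hvw i) (hx i)
  have huv : ∀ i j, i ≠ j → u i ≠ u j := by
    intro i j hij h
    simp only [u] at h
    rw [div_eq_div_iff (hx i) (hx j)] at h
    refine mul_ne_zero (hv i j hij) hxw ?_
    simp only [gzBr] at h ⊢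
    linear_combination h
  have hF : ∀ l : Fin m → K, gzF l v w x = (∏ j, gzBr x (v j)) * ∑ i, l i * u i := by
    intro l
    rw [gzF, Finset.mul_sum]
    refine Finset.sum_congr rfl fun i _ => ?_
    rw [← Finset.mul_prod_erase _ _ (Finset.mem_univ i)]
    have := hx i
    simp only [u]
    field_simp
  let U : (Fin m → K) →ₗ[K] K := Fintype.linearCombination K u
  have hU : ∀ l, U l = ∑ i, l i * u i := fun l => by
    simp [U, Fintype.linearCombination_apply]
  let V := LinearMap.ker U
  let q : Option (Fin m) → (V →ₗ[K] K) := fun o =>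
    (match o with
      | none => Fintype.linearCombination K (fun _ : Fin m => (1 : K))
      | some i => LinearMap.proj i) ∘ₗ V.subtype
  have key : ∀ i j, i ≠ j → (u j • Pi.single i (1 : K) - u i • Pi.single j 1 : Fin m → K) ∈ V := by
    intro i j hij
    rw [LinearMap.mem_ker, hU]
    simp [sub_mul, Finset.sum_sub_distrib, Pi.single_apply]
    ring
  have hne : ⋃ o, (LinearMap.ker (q o) : Set V) ≠ Set.univ := by
    intro h
    obtain ⟨o, ho⟩ := Subspace.exists_eq_top_of_iUnion_eq_univ h
    rw [LinearMap.ker_eq_top] at ho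
    cases o with
    | none =>
      have h01 : (⟨0, by omega⟩ : Fin m) ≠ ⟨1, by omega⟩ := by simp
      have := LinearMap.congr_fun ho ⟨_, key _ _ h01⟩
      simp [q, Fintype.linearCombination_apply, Finset.sum_sub_distrib, Pi.single_apply] at this
      exact huv _ _ h01 (sub_eq_zero.mp this).symm
    | some i =>
      have : Nontrivial (Fin m) := Fin.nontrivial_iff_two_le.mpr hm
      obtain ⟨j, hj⟩ := exists_ne i
      have := LinearMap.congr_fun ho ⟨_, key _ _ hj.symm⟩
      simp [q, hj.symm] at this
      exact hu _ this
  obtain ⟨⟨l, hl⟩, hlq⟩ := (Set.ne_univ_iff_exists_notMem _).mp hne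
  simp only [Set.mem_iUnion, not_exists, SetLike.mem_coe, LinearMap.mem_ker] at hlq
  refine ⟨l, fun i => ?_, ?_, ?_⟩
  · simpa [q] using hlq (some i)
  · simpa [q, Fintype.linearCombination_apply] using hlq none
  · rw [hF, ← hU, LinearMap.mem_ker.mp hl, mul_zero]

lemma gz_smul_of_br {K : Type*} [Field K] (x y : Fin 2 → K) (hx : x ≠ 0) (h : gzBr x y = 0) :
    ∃ c, ∀ j, y j = c * x j := by
  simp only [gzBr] at h
  by_cases h0 : x 0 = 0
  · have h1 : x 1 ≠ 0 := fun h1 => hx (by ext i; fin_cases i <;> simp [h0, h1])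
    refine ⟨y 1 / x 1, fun j => ?_⟩
    fin_cases j
    · simp [h0] at h ⊢; tauto
    · simp [h1]
  · refine ⟨y 0 / x 0, fun j => ?_⟩
    fin_cases j
    · simp [h0]
    · simp; field_simp; linear_combination h

end GZAlg

section GZGeo

abbrev gzA (K : Type) [Field K] := MvPolynomial.homogeneousSubmodule (Fin 2) K
noncomputable abbrev gzP (K : Type) [Field K] : Scheme := Proj (gzA K)
noncomputable abbrev gzStr (K : Type) [Field K] : gzP K ⟶ Spec (CommRingCat.of K) :=
  Proj.toSpecZero (gzA K) ≫
    Spec.map (CommRingCat.ofHom (algebraMap K ↥(gzA K 0)))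

variable {K : Type} [Field K]

lemma gzX_mem (i : Fin 2) : (MvPolynomial.X i : MvPolynomial (Fin 2) K) ∈ gzA K 1 :=
  MvPolynomial.isHomogeneous_X _ _

/-- `f / X i` in `Away (X i)` -/
noncomputable def gzFrac (i : Fin 2) (f : MvPolynomial (Fin 2) K) (hf : f ∈ gzA K 1) :
    HomogeneousLocalization.Away (gzA K) (MvPolynomial.X i) :=
  HomogeneousLocalization.Away.mk (gzA K) (gzX_mem i) 1 f (by simpa using hf)

/-- K → Away -/
noncomputable def gzAlg (f : MvPolynomial (Fin 2) K) :
    K →+* HomogeneousLocalization.Away (gzA K) f :=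
  (HomogeneousLocalization.fromZeroRingHom (gzA K) _).comp (algebraMap K ↥(gzA K 0))

lemma gz_away_str {f : MvPolynomial (Fin 2) K} {d : ℕ} (hf : f ∈ gzA K d) (hd : 0 < d) :
    Proj.awayι (gzA K) f hf hd ≫ gzStr K = Spec.map (CommRingCat.ofHom (gzAlg f)) := by
  rw [gzStr, Proj.awayι_toSpecZero_assoc, ← Spec.map_comp]
  rfl

lemma gz_val_alg (f : MvPolynomial (Fin 2) K) (c : K) :
    (gzAlg f c).val = algebraMap (MvPolynomial (Fin 2) K) _ (MvPolynomial.C c) := by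
  simp [gzAlg]
  rfl

lemma gz_val_frac (i : Fin 2) (f : MvPolynomial (Fin 2) K) (hf : f ∈ gzA K 1) :
    algebraMap (MvPolynomial (Fin 2) K) _ (MvPolynomial.X i) * (gzFrac i f hf).val = algebraMap _ _ f := by
  rw [gzFrac, HomogeneousLocalization.Away.val_mk]
  rw [Localization.mk_eq_mk', mul_comm]
  simp

lemma gz_homog_eval {K R : Type*} [CommRing K] [CommRing R] (φ : K →+* R) (c : R) (x : Fin 2 → R)
    (d : ℕ) (s : MvPolynomial (Fin 2) K) (hs : s.IsHomogeneous d) :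
    s.eval₂ φ (fun j => c * x j) = c ^ d * s.eval₂ φ x := by
  rw [MvPolynomial.eval₂_eq, MvPolynomial.eval₂_eq, Finset.mul_sum]
  refine Finset.sum_congr rfl fun e he => ?_
  have := hs.degree_eq_sum_deg_support he
  simp only [mul_pow, Finset.prod_mul_distrib]
  rw [Finset.prod_pow_eq_pow_sum, this]
  ring

lemma gz_theta_surj (i : Fin 2) : Function.Surjective
    (MvPolynomial.eval₂Hom (gzAlg (K := K) (MvPolynomial.X i))
      (fun j => gzFrac i (MvPolynomial.X j) (gzX_mem j))) := by
  intro a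
  obtain ⟨d, s, hs, rfl⟩ := HomogeneousLocalization.Away.mk_surjective (gzA K) (gzX_mem i) a
  refine ⟨s, HomogeneousLocalization.val_injective _ ?_⟩
  have hs' : s.IsHomogeneous d := by simpa using hs
  have h1 : (MvPolynomial.eval₂Hom (gzAlg (K := K) (MvPolynomial.X i))
      (fun j => gzFrac i (MvPolynomial.X j) (gzX_mem j)) s).val =
      s.eval₂ ((algebraMap (MvPolynomial (Fin 2) K) (Localization.Away (MvPolynomial.X i : MvPolynomial (Fin 2) K))).comp
        (MvPolynomial.C)) (fun j => (gzFrac i (MvPolynomial.X j) (gzX_mem j)).val) := by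
    rw [← HomogeneousLocalization.algebraMap_apply, MvPolynomial.coe_eval₂Hom,
      MvPolynomial.hom_eval₂]
    congr 1
  rw [h1, HomogeneousLocalization.Away.val_mk, Localization.mk_eq_mk', IsLocalization.eq_mk'_iff_mul_eq]
  simp only [map_pow]
  rw [mul_comm, ← gz_homog_eval _ _ _ _ _ hs']
  simp only [gz_val_frac]
  refine (MvPolynomial.hom_eval₂ s MvPolynomial.C (algebraMap (MvPolynomial (Fin 2) K)
    (Localization.Away (MvPolynomial.X i : MvPolynomial (Fin 2) K))) MvPolynomial.X).symm.trans ?_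
  rw [MvPolynomial.eval₂_eta]

lemma gz_away_hom_ext {R : Type*} [CommRing R] (i : Fin 2)
    (f g : HomogeneousLocalization.Away (gzA K) (MvPolynomial.X i) →+* R)
    (h : ∀ c, f (gzAlg _ c) = g (gzAlg _ c))
    (h' : ∀ j, f (gzFrac i (MvPolynomial.X j) (gzX_mem j)) = g (gzFrac i (MvPolynomial.X j) (gzX_mem j))) :
    f = g := by
  refine (RingHom.cancel_right (gz_theta_surj i)).mp (MvPolynomial.ringHom_ext ?_ ?_)
  · intro c; simpa using h c
  · intro j; simpa using h' j

lemma gz_away_hom_exists {R : Type*} [Field R] (i : Fin 2) (φ : K →+* R) (v : Fin 2 → R)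
    (hv : v i ≠ 0) : ∃ f : HomogeneousLocalization.Away (gzA K) (MvPolynomial.X i) →+* R,
    (∀ c, f (gzAlg _ c) = φ c) ∧
    ∀ j, v i * f (gzFrac i (MvPolynomial.X j) (gzX_mem j)) = v j := by
  have hu : IsUnit (MvPolynomial.eval₂Hom φ v (MvPolynomial.X i)) := by simpa using hv
  let F := IsLocalization.Away.lift (S := Localization.Away (MvPolynomial.X i : MvPolynomial (Fin 2) K))
    (MvPolynomial.X i) hu
  refine ⟨F.comp (algebraMap _ _), fun c => ?_, fun j => ?_⟩
  · simp [gz_val_alg, F]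
  · have := congrArg F (gz_val_frac (K := K) i (MvPolynomial.X j) (gzX_mem j))
    simpa [F] using this

/-- Away (X i) → κ(q) -/
noncomputable def gzPsi (q : gzP K) (f : MvPolynomial (Fin 2) K) 
    (hq : q ∈ Proj.basicOpen (gzA K) f) :
    CommRingCat.of (HomogeneousLocalization.Away (gzA K) f) ⟶ (gzP K).residueField q :=
  Proj.awayToSection (gzA K) f ≫ (gzP K).evaluation _ q hq

lemma gz_psi_spec (q : gzP K) (f : MvPolynomial (Fin 2) K) {d : ℕ} (hf : f ∈ gzA K d) (hd : 0 < d)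
    (hq : q ∈ Proj.basicOpen (gzA K) f) :
    Spec.map (gzPsi q f hq) ≫ Proj.awayι (gzA K) f hf hd = (gzP K).fromSpecResidueField q := by
  have h := Scheme.Opens.fromSpecStalkOfMem_toSpecΓ (Proj.basicOpen (gzA K) f) q hq
  rw [gzPsi, ← Scheme.germ_residue, Spec.map_comp, Spec.map_comp, ← h, Proj.awayι]
  have h2 : (Proj.basicOpen (gzA K) f).toSpecΓ ≫ Spec.map (Proj.awayToSection (gzA K) f) =
    (Proj.basicOpenIsoSpec (gzA K) f hf hd).hom := rfl
  simp only [Category.assoc]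
  rw [reassoc_of% h2, Iso.hom_inv_id_assoc, Scheme.Opens.fromSpecStalkOfMem_ι]
  rfl

lemma gz_psi_eq (q : gzP K) (f : MvPolynomial (Fin 2) K) 
    (hq : q ∈ Proj.basicOpen (gzA K) f) :
    gzPsi q f hq = CommRingCat.ofHom (HomogeneousLocalization.mapId (gzA K) (Submonoid.powers_le.mpr hq)) ≫
      (Proj.stalkIso (gzA K) q).inv ≫ (gzP K).residue q := by
  have := ProjectiveSpectrum.Proj.awayToSection_germ (gzA K) f q hq
  rw [gzPsi, ← Scheme.germ_residue]
  exact congr($this ≫ (gzP K).residue q)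

end GZGeo

section GZGeo
variable {K : Type} [Field K]

lemma gz_exists_idx (q : gzP K) : ∃ i : Fin 2, q ∈ Proj.basicOpen (gzA K) (MvPolynomial.X i) := by
  by_contra! h
  have h2 : ∀ i : Fin 2, (MvPolynomial.X i : MvPolynomial (Fin 2) K) ∈ q.asHomogeneousIdeal := by
    intro i
    have := h i
    rw [Proj.mem_basicOpen] at this
    simpa using this
  refine q.not_irrelevant_le ?_
  intro f hf
  have hf0 : f.coeff 0 = 0 := by
    have h3 : GradedRing.proj (gzA K) 0 f = 0 := hf
    have h4 : MvPolynomial.homogeneousComponent 0 f = 0 :=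
      (MvPolynomial.decomposition.decompose'_apply (R := K) f 0).symm.trans h3
    rw [MvPolynomial.homogeneousComponent_zero] at h4
    simpa using h4
  have : f ∈ Ideal.span (MvPolynomial.X '' Set.univ : Set (MvPolynomial (Fin 2) K)) := by
    rw [MvPolynomial.mem_ideal_span_X_image]
    intro m hm
    by_contra! h5
    have : m = 0 := by ext i; simpa using h5 i
    rw [MvPolynomial.mem_support_iff, this] at hm
    exact hm hf0
  refine (Ideal.span_le.mpr ?_) this
  rintro _ ⟨i, -, rfl⟩
  exact h2 i

lemma gz_mapId_val (P : Ideal (MvPolynomial (Fin 2) K)) [P.IsPrime] (i : Fin 2)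
    (hi : Submonoid.powers (MvPolynomial.X i : MvPolynomial (Fin 2) K) ≤ P.primeCompl)
    (f : MvPolynomial (Fin 2) K) (hf : f ∈ gzA K 1) :
    (HomogeneousLocalization.mapId (gzA K) hi (gzFrac i f hf)).val =
      Localization.mk f ⟨MvPolynomial.X i ^ 1, hi ⟨1, rfl⟩⟩ := rfl

lemma gz_mapId_trans (P : Ideal (MvPolynomial (Fin 2) K)) [P.IsPrime] (i i' : Fin 2)
    (hi : Submonoid.powers (MvPolynomial.X i : MvPolynomial (Fin 2) K) ≤ P.primeCompl)
    (hi' : Submonoid.powers (MvPolynomial.X i' : MvPolynomial (Fin 2) K) ≤ P.primeCompl)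
    (f : MvPolynomial (Fin 2) K) (hf : f ∈ gzA K 1) :
    HomogeneousLocalization.mapId (gzA K) hi (gzFrac i f hf) =
      HomogeneousLocalization.mapId (gzA K) hi (gzFrac i (MvPolynomial.X i') (gzX_mem i')) *
      HomogeneousLocalization.mapId (gzA K) hi' (gzFrac i' f hf) := by
  apply HomogeneousLocalization.val_injective
  rw [HomogeneousLocalization.val_mul, gz_mapId_val, gz_mapId_val, gz_mapId_val, Localization.mk_mul]
  rw [Localization.mk_eq_mk_iff, Localization.r_iff_exists]
  refine ⟨1, ?_⟩
  simp
  ring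

lemma gz_mapId_mem (P : Ideal (MvPolynomial (Fin 2) K)) [P.IsPrime] (i : Fin 2)
    (hi : Submonoid.powers (MvPolynomial.X i : MvPolynomial (Fin 2) K) ≤ P.primeCompl)
    (f : MvPolynomial (Fin 2) K) (hf : f ∈ gzA K 1) (hfP : f ∈ P) :
    ¬ IsUnit (HomogeneousLocalization.mapId (gzA K) hi (gzFrac i f hf)) := by
  intro hu3
  rw [← HomogeneousLocalization.isUnit_iff_isUnit_val] at hu3
  rw [gz_mapId_val, Localization.mk_eq_mk'] at hu3
  exact (IsLocalization.AtPrime.isUnit_mk'_iff _ P _ _).mp hu3 hfP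

instance gz_isPrime (q : gzP K) : q.asHomogeneousIdeal.toIdeal.IsPrime := q.isPrime

lemma gz_psi_apply (q : gzP K) (f : MvPolynomial (Fin 2) K)
    (hq : q ∈ Proj.basicOpen (gzA K) f) (a : HomogeneousLocalization.Away (gzA K) f) :
    gzPsi q f hq a = ((Proj.stalkIso (gzA K) q).inv ≫ (gzP K).residue q).hom
      (HomogeneousLocalization.mapId (gzA K) (Submonoid.powers_le.mpr hq :
        _ ≤ q.asHomogeneousIdeal.toIdeal.primeCompl) a) := by
  rw [gz_psi_eq]; rfl

lemma gz_psi_trans (q : gzP K) (i i' : Fin 2) (hi : q ∈ Proj.basicOpen (gzA K) (MvPolynomial.X i))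
    (hi' : q ∈ Proj.basicOpen (gzA K) (MvPolynomial.X i')) (f : MvPolynomial (Fin 2) K)
    (hf : f ∈ gzA K 1) :
    gzPsi q _ hi (gzFrac i f hf) =
      gzPsi q _ hi (gzFrac i (MvPolynomial.X i') (gzX_mem i')) * gzPsi q _ hi' (gzFrac i' f hf) := by
  rw [gz_psi_apply, gz_psi_apply, gz_psi_apply]
  refine Eq.trans (congrArg _ ?_) (map_mul _ _ _)
  exact gz_mapId_trans q.asHomogeneousIdeal.toIdeal i i' _ _ f hf

lemma gz_psi_self (q : gzP K) (i : Fin 2) (hi : q ∈ Proj.basicOpen (gzA K) (MvPolynomial.X i)) :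
    gzPsi q _ hi (gzFrac i (MvPolynomial.X i) (gzX_mem i)) = 1 := by
  have : gzFrac i (MvPolynomial.X i : MvPolynomial (Fin 2) K) (gzX_mem i) = 1 := by
    apply HomogeneousLocalization.val_injective
    simp [gzFrac]
  rw [this, map_one]

lemma gz_psi_zero (q : gzP K) (i : Fin 2) (hi : q ∈ Proj.basicOpen (gzA K) (MvPolynomial.X i))
    (f : MvPolynomial (Fin 2) K) (hf : f ∈ gzA K 1) (hq : q ∉ Proj.basicOpen (gzA K) f) :
    gzPsi q _ hi (gzFrac i f hf) = 0 := by
  have hq' : f ∈ q.asHomogeneousIdeal := by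
    rw [Proj.mem_basicOpen] at hq
    simpa using hq
  rw [gz_psi_apply]
  refine (IsLocalRing.residue_eq_zero_iff _).mpr ?_
  rw [IsLocalRing.mem_maximalIdeal, mem_nonunits_iff]
  intro hu
  have hu2 := hu.map (Proj.stalkIso (gzA K) q).hom.hom
  have hu3 : IsUnit (HomogeneousLocalization.mapId (gzA K) (Submonoid.powers_le.mpr hi :
        _ ≤ q.asHomogeneousIdeal.toIdeal.primeCompl)
      (gzFrac i f hf)) := by
    have h9 : ∀ b : HomogeneousLocalization.AtPrime (gzA K) q.asHomogeneousIdeal.toIdeal,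
        (Proj.stalkIso (gzA K) q).hom.hom ((Proj.stalkIso (gzA K) q).inv.hom b) = b := fun b =>
      congr($((Proj.stalkIso (gzA K) q).inv_hom_id).hom b)
    exact (congrArg IsUnit (h9 _)).mp hu2
  exact gz_mapId_mem q.asHomogeneousIdeal.toIdeal i _ f hf hq' hu3

noncomputable def gzCrd0 (q : gzP K) : Fin 2 → (gzP K).residueField q := fun j =>
  gzPsi q _ (gz_exists_idx q).choose_spec (gzFrac _ (MvPolynomial.X j) (gzX_mem j))

lemma gz_crd0_mul (q : gzP K) (i : Fin 2) (hi : q ∈ Proj.basicOpen (gzA K) (MvPolynomial.X i))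
    (j : Fin 2) : gzCrd0 q j = gzCrd0 q i * gzPsi q _ hi (gzFrac i (MvPolynomial.X j) (gzX_mem j)) :=
  gz_psi_trans _ _ _ _ _ _ _

lemma gz_crd0_ne (q : gzP K) (i : Fin 2) :
    gzCrd0 q i ≠ 0 ↔ q ∈ Proj.basicOpen (gzA K) (MvPolynomial.X i) := by
  constructor
  · intro h
    by_contra h2
    exact h (gz_psi_zero _ _ _ _ _ h2)
  · intro hi h
    have := gz_crd0_mul q i hi (gz_exists_idx q).choose
    rw [h, zero_mul, gzCrd0, gz_psi_self] at this
    exact one_ne_zero this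

lemma gz_crd0_ne_zero (q : gzP K) : gzCrd0 q ≠ 0 := by
  obtain ⟨i, hi⟩ := gz_exists_idx q
  intro h
  exact (gz_crd0_ne q i).mpr hi (congrFun h i)

/-- K → κ(y) -/
noncomputable def gzK {Y : Scheme} (sY : Y ⟶ Spec (CommRingCat.of K)) (y : Y) :
    CommRingCat.of K ⟶ Y.residueField y :=
  (Scheme.ΓSpecIso _).inv ≫ sY.appTop ≫ Y.Γevaluation y

lemma gzK_spec {Y : Scheme} (sY : Y ⟶ Spec (CommRingCat.of K)) (y : Y) :
    Spec.map (gzK sY y) = Y.fromSpecResidueField y ≫ sY := by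
  have h1 : Y.fromSpecResidueField y ≫ Y.toSpecΓ = Spec.map (Y.Γevaluation y) := by
    rw [Scheme.fromSpecResidueField, Category.assoc, Scheme.fromSpecStalk_toSpecΓ, ← Spec.map_comp]
    rfl
  rw [gzK, Spec.map_comp, Spec.map_comp, Category.assoc, ← h1, Category.assoc,
    ← Scheme.toSpecΓ_naturality_assoc]
  simp

lemma gzK_comp {Y Y' : Scheme} (h : Y' ⟶ Y) (sY : Y ⟶ Spec (CommRingCat.of K)) (y : Y') :
    gzK (h ≫ sY) y = gzK sY (h y) ≫ h.residueFieldMap y := by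
  apply Spec.map_injective
  rw [Spec.map_comp, gzK_spec, gzK_spec, Scheme.Hom.SpecMap_residueFieldMap_fromSpecResidueField_assoc]

lemma gz_psi_alg (q : gzP K) (i : Fin 2) (hi : q ∈ Proj.basicOpen (gzA K) (MvPolynomial.X i)) (c : K) :
    gzPsi q _ hi (gzAlg _ c) = gzK (gzStr K) q c := by
  have : gzK (gzStr K) q = CommRingCat.ofHom (gzAlg _) ≫ gzPsi q _ hi := by
    apply Spec.map_injective
    rw [Spec.map_comp, gzK_spec, ← gz_psi_spec q _ (gzX_mem i) one_pos hi, Category.assoc, gz_away_str]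
  rw [this]; rfl

/-- the linear form vanishing at `a` -/
noncomputable def gzLin (a : Fin 2 → K) : MvPolynomial (Fin 2) K :=
  MvPolynomial.C (a 1) * MvPolynomial.X 0 - MvPolynomial.C (a 0) * MvPolynomial.X 1

lemma gzLin_mem (a : Fin 2 → K) : gzLin a ∈ gzA K 1 := by
  refine Submodule.sub_mem _ ?_ ?_ <;>
  · simpa using (MvPolynomial.isHomogeneous_C _ _).mul (MvPolynomial.isHomogeneous_X K _)

lemma gz_lin (q : gzP K) (a : Fin 2 → K) (hq : q ∉ Proj.basicOpen (gzA K) (gzLin a)) :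
    gzBr (gzCrd0 q) (gzK (gzStr K) q ∘ a) = 0 := by
  obtain ⟨i, hi, hi2⟩ : ∃ i, ∃ hi : q ∈ Proj.basicOpen (gzA K) (MvPolynomial.X i), 
    ∀ j, gzCrd0 q j = gzPsi q _ hi (gzFrac i (MvPolynomial.X j) (gzX_mem j)) := 
    ⟨_, (gz_exists_idx q).choose_spec, fun j => rfl⟩
  have h0 := gz_psi_zero q i hi _ (gzLin_mem a) hq
  have : gzFrac i (gzLin a) (gzLin_mem a) =
      gzAlg _ (a 1) * gzFrac i (MvPolynomial.X 0) (gzX_mem 0)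
      - gzAlg _ (a 0) * gzFrac i (MvPolynomial.X 1) (gzX_mem 1) := by
    apply HomogeneousLocalization.val_injective
    have hu : IsUnit (algebraMap (MvPolynomial (Fin 2) K)
      (Localization.Away (MvPolynomial.X i : MvPolynomial (Fin 2) K)) (MvPolynomial.X i)) :=
      IsLocalization.Away.algebraMap_isUnit _
    refine hu.mul_left_cancel ?_
    rw [gz_val_frac]
    have h0 := gz_val_frac (K := K) i (MvPolynomial.X 0) (gzX_mem 0)
    have h1 := gz_val_frac (K := K) i (MvPolynomial.X 1) (gzX_mem 1)
    have h2 := gz_val_alg (K := K) (MvPolynomial.X i) (a 0)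
    have h3 := gz_val_alg (K := K) (MvPolynomial.X i) (a 1)
    rw [HomogeneousLocalization.val_sub, HomogeneousLocalization.val_mul,
      HomogeneousLocalization.val_mul, h2, h3, mul_sub, mul_left_comm]
    refine Eq.trans ?_ (congrArg₂ (· - ·) (congrArg (_ * ·) h0.symm)
      ((congrArg (_ * ·) h1.symm).trans (mul_left_comm _ _ _)))
    simp only [gzLin, map_sub, map_mul]
  rw [this, map_sub, map_mul, map_mul, gz_psi_alg, gz_psi_alg, ← hi2, ← hi2] at h0
  simp only [gzBr, Function.comp]
  exact (congrArg₂ _ (mul_comm _ _) (mul_comm _ _)).trans h0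

end GZGeo

section GZGeo
variable {K : Type} [Field K]

noncomputable def gzCrd {Y : Scheme} (g : Y ⟶ gzP K) (y : Y) : Fin 2 → Y.residueField y :=
  fun j => g.residueFieldMap y (gzCrd0 (g y) j)

lemma gz_crd_comp {Y Y' : Scheme} (h : Y' ⟶ Y) (g : Y ⟶ gzP K) (y : Y') (j : Fin 2) :
    gzCrd (h ≫ g) y j = h.residueFieldMap y (gzCrd g (h y) j) := by
  have := Scheme.residueFieldMap_comp h g y
  simp only [gzCrd]
  rw [this]
  rfl

lemma gz_crd_congr {Y : Scheme} {g g' : Y ⟶ gzP K} (h : g = g') : gzCrd g = gzCrd g' := by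
  rw [h]

lemma gz_crd_ne {Y : Scheme} (g : Y ⟶ gzP K) (y : Y) (i : Fin 2) :
    gzCrd g y i ≠ 0 ↔ g y ∈ Proj.basicOpen (gzA K) (MvPolynomial.X i) := by
  rw [← gz_crd0_ne, gzCrd]
  exact (map_ne_zero (g.residueFieldMap y).hom)

lemma gz_crd_ne_zero {Y : Scheme} (g : Y ⟶ gzP K) (y : Y) : gzCrd g y ≠ 0 := by
  obtain ⟨i, hi⟩ := gz_exists_idx (g y)
  intro h
  exact (gz_crd_ne g y i).mpr hi (congrFun h i)

lemma gz_crd_mul {Y : Scheme} (g : Y ⟶ gzP K) (y : Y) (i : Fin 2)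
    (hi : g y ∈ Proj.basicOpen (gzA K) (MvPolynomial.X i)) (j : Fin 2) :
    gzCrd g y j = gzCrd g y i *
      g.residueFieldMap y (gzPsi (g y) _ hi (gzFrac i (MvPolynomial.X j) (gzX_mem j))) := by
  simp only [gzCrd]
  refine (congrArg _ (gz_crd0_mul (g y) i hi j)).trans (map_mul _ _ _)

lemma gz_fac {Y : Scheme} (g : Y ⟶ gzP K) (y : Y) (i : Fin 2)
    (hi : g y ∈ Proj.basicOpen (gzA K) (MvPolynomial.X i)) :
    Y.fromSpecResidueField y ≫ g = Spec.map (gzPsi (g y) _ hi ≫ g.residueFieldMap y) ≫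
      Proj.awayι (gzA K) _ (gzX_mem i) one_pos := by
  rw [← Scheme.Hom.SpecMap_residueFieldMap_fromSpecResidueField,
    ← gz_psi_spec (g y) _ (gzX_mem i) one_pos hi, Spec.map_comp, Category.assoc]

lemma gz_eq_of_br {Y : Scheme} (g g' : Y ⟶ gzP K) (y : Y) (hg : g ≫ gzStr K = g' ≫ gzStr K)
    (h : gzBr (gzCrd g y) (gzCrd g' y) = 0) :
    Y.fromSpecResidueField y ≫ g = Y.fromSpecResidueField y ≫ g' := by
  obtain ⟨c, hc⟩ := gz_smul_of_br _ _ (gz_crd_ne_zero g y) h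
  obtain ⟨i, hi'⟩ := gz_exists_idx (g' y)
  have hne' := (gz_crd_ne g' y i).mpr hi'
  have hne : gzCrd g y i ≠ 0 := by
    intro h0
    rw [hc, h0, mul_zero] at hne'
    exact hne' rfl
  have hc0 : c ≠ 0 := by
    intro h0
    rw [hc, h0, zero_mul] at hne'
    exact hne' rfl
  have hi := (gz_crd_ne g y i).mp hne
  rw [gz_fac g y i hi, gz_fac g' y i hi']
  congr 2
  ext1
  refine gz_away_hom_ext i _ _ ?_ ?_
  · intro a
    have e1 : ∀ (g : Y ⟶ gzP K) (hi : g y ∈ Proj.basicOpen (gzA K) (MvPolynomial.X i)),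
      (gzPsi (g y) _ hi ≫ g.residueFieldMap y).hom (gzAlg _ a) = gzK (g ≫ gzStr K) y a := by
      intro g hi
      rw [gzK_comp]
      exact congrArg (g.residueFieldMap y).hom (gz_psi_alg (g y) i hi a)
    rw [e1, e1, hg]
  · intro j
    have h1 := gz_crd_mul g y i hi j
    have h2 := gz_crd_mul g' y i hi' j
    rw [hc j, hc i, h1, mul_assoc] at h2
    exact mul_left_cancel₀ hne (mul_left_cancel₀ hc0 h2)

/-- locally given by sections, up to unit -/
def gzGood {Y : Scheme} (c : ∀ y : Y, Fin 2 → Y.residueField y) : Prop :=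
  ∀ y : Y, ∃ W : Y.Opens, y ∈ W ∧ ∃ s : Fin 2 → Γ(Y, W), ∀ (y' : Y) (hy' : y' ∈ W),
    ∃ e : Y.residueField y', e ≠ 0 ∧ ∀ j, c y' j = e * Y.evaluation W y' hy' (s j)

lemma gz_good_crd {Y : Scheme} (g : Y ⟶ gzP K) : gzGood (gzCrd g) := by
  intro y
  obtain ⟨i, hi⟩ := gz_exists_idx (g y)
  refine ⟨g ⁻¹ᵁ Proj.basicOpen (gzA K) (MvPolynomial.X i), hi, fun j =>
    g.app _ (Proj.awayToSection (gzA K) _ (gzFrac i (MvPolynomial.X j) (gzX_mem j))),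
    fun y' hy' => ⟨gzCrd g y' i, (gz_crd_ne g y' i).mpr hy', fun j => ?_⟩⟩
  refine (gz_crd_mul g y' i hy' j).trans (congrArg _ ?_)
  exact Scheme.evaluation_naturality_apply g y' hy' _

lemma gz_ev_res {Y : Scheme} (W W' : Y.Opens) (h : W' ≤ W) (y : Y) (hy : y ∈ W') (s : Γ(Y, W)) :
    Y.evaluation W' y hy (Y.presheaf.map (homOfLE h).op s) = Y.evaluation W y (h hy) s := by
  have : Y.presheaf.map (homOfLE h).op ≫ Y.evaluation W' y hy = Y.evaluation W y (h hy) := by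
    rw [Scheme.evaluation, Scheme.evaluation, ← Category.assoc, TopCat.Presheaf.germ_res]
  rw [← this]; rfl

lemma gz_good_const {Y : Scheme} (sY : Y ⟶ Spec (CommRingCat.of K)) (a : Fin 2 → K) :
    gzGood (fun y => fun j => gzK sY y (a j)) := by
  intro y
  refine ⟨⊤, trivial, fun j => ((Scheme.ΓSpecIso _).inv ≫ sY.appTop).hom (a j), fun y' hy' =>
    ⟨1, one_ne_zero, fun j => ?_⟩⟩
  rw [one_mul]
  rfl

lemma gz_open {Y : Scheme} (sY : Y ⟶ Spec (CommRingCat.of K)) {m : ℕ} (l : Fin m → K)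
    (v : Fin m → ∀ y : Y, Fin 2 → Y.residueField y) (w x : ∀ y : Y, Fin 2 → Y.residueField y)
    (hv : ∀ i, gzGood (v i)) (hw : gzGood w) (hx : gzGood x) :
    IsOpen {y : Y | gzF (fun i => gzK sY y (l i)) (fun i => v i y) (w y) (x y) ≠ 0} := by
  rw [isOpen_iff_forall_mem_open]
  intro y hy
  choose V hV sv hsv using fun i => hv i y
  obtain ⟨W1, hW1, sw, hsw⟩ := hw y
  obtain ⟨W2, hW2, sx, hsx⟩ := hx y
  let W : Y.Opens := (⨅ i, V i) ⊓ W1 ⊓ W2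
  have hyW : y ∈ W := by
    refine ⟨⟨?_, hW1⟩, hW2⟩
    rw [TopologicalSpace.Opens.coe_iInf]
    exact Set.mem_iInter.mpr hV
  have hWV : ∀ i, W ≤ V i := fun i => (inf_le_left.trans inf_le_left).trans (iInf_le _ i)
  have hWW1 : W ≤ W1 := inf_le_left.trans inf_le_right
  have hWW2 : W ≤ W2 := inf_le_right
  let G : Γ(Y, W) := gzF (fun i => Y.presheaf.map (homOfLE le_top).op
      (((Scheme.ΓSpecIso _).inv ≫ sY.appTop).hom (l i)))
    (fun i j => Y.presheaf.map (homOfLE (hWV i)).op (sv i j))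
    (fun j => Y.presheaf.map (homOfLE hWW1).op (sw j))
    (fun j => Y.presheaf.map (homOfLE hWW2).op (sx j))
  have key : ∀ y' (hy' : y' ∈ W), (gzF (fun i => gzK sY y' (l i)) (fun i => v i y') (w y') (x y') ≠ 0
      ↔ y' ∈ Y.basicOpen G) := by
    intro y' hy'
    rw [← Scheme.evaluation_ne_zero_iff_mem_basicOpen _ _ hy']
    choose c hc0 hc using fun i => hsv i y' (hWV i hy')
    obtain ⟨d, hd0, hd⟩ := hsw y' (hWW1 hy')
    obtain ⟨e, he0, he⟩ := hsx y' (hWW2 hy')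
    rw [gzF_smul _ _ _ _ _ _ _ c d e hc hd he]
    have hG : (Y.evaluation W y' hy').hom G = gzF (fun i => gzK sY y' (l i))
        (fun i j => Y.evaluation _ y' (hWV i hy') (sv i j))
        (fun j => Y.evaluation _ y' (hWW1 hy') (sw j))
        (fun j => Y.evaluation _ y' (hWW2 hy') (sx j)) := by
      rw [← gzF_map]
      congr 1
      · funext i; exact gz_ev_res _ _ _ _ _ _
      · funext i j; exact gz_ev_res _ _ _ _ _ _
      · funext j; exact gz_ev_res _ _ _ _ _ _
      · funext j; exact gz_ev_res _ _ _ _ _ _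
    refine Iff.trans ?_ (Iff.of_eq (congrArg (· ≠ 0) hG.symm))
    have : ((∏ i, c i) * d * e ^ (m - 1)) ≠ 0 :=
      mul_ne_zero (mul_ne_zero (Finset.prod_ne_zero_iff.mpr fun i _ => hc0 i) hd0) (pow_ne_zero _ he0)
    rw [mul_ne_zero_iff]
    exact ⟨fun h => h.2, fun h => ⟨this, h⟩⟩
  refine ⟨Y.basicOpen G, fun y' hy' => ?_, (Y.basicOpen G).isOpen, (key y hyW).mp hy⟩
  exact (key y' (Y.basicOpen_le G hy')).mpr hy'

lemma gz_point {Y : Scheme} (g : Y ⟶ gzP K) (y : Y) (L : Type) [Field L]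
    (δ : Y.residueField y ⟶ CommRingCat.of L) (i : Fin 2)
    (f : HomogeneousLocalization.Away (gzA K) (MvPolynomial.X i) →+* L)
    (h : Spec.map δ ≫ Y.fromSpecResidueField y ≫ g = Spec.map (CommRingCat.ofHom f) ≫
      Proj.awayι (gzA K) _ (gzX_mem i) one_pos) :
    ∃ c : L, ∀ j, δ (gzCrd g y j) = c * f (gzFrac i (MvPolynomial.X j) (gzX_mem j)) := by
  have hi : g y ∈ Proj.basicOpen (gzA K) (MvPolynomial.X i) := by
    have h1 : ∀ p : Spec (CommRingCat.of L), (Spec.map δ ≫ Y.fromSpecResidueField y ≫ g) p = g y := by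
      intro p
      rw [Scheme.Hom.comp_apply, Scheme.Hom.comp_apply, Scheme.fromSpecResidueField_apply]
    rw [← Proj.opensRange_awayι (gzA K) _ (gzX_mem i) one_pos,
      ← h1 (IsLocalRing.closedPoint L), h]
    exact ⟨Spec.map (CommRingCat.ofHom f) (IsLocalRing.closedPoint L), rfl⟩
  refine ⟨δ (gzCrd g y i), fun j => ?_⟩
  rw [gz_fac g y i hi, ← Category.assoc, cancel_mono, ← Spec.map_comp] at h
  have h2 := Spec.map_injective h
  refine ((congrArg _ (gz_crd_mul g y i hi j)).trans (map_mul _ _ _)).trans (congrArg _ ?_)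
  exact congr(($h2).hom (gzFrac i (MvPolynomial.X j) (gzX_mem j)))

end GZGeo

section GZGeo
variable {K : Type} [Field K]

lemma gz_zero_bij : Function.Bijective (algebraMap K ↥(gzA K 0)) := by
  have hinj : Function.Injective (algebraMap K ↥(gzA K 0)) := fun a b h =>
    MvPolynomial.C_injective (Fin 2) K (congrArg Subtype.val h)
  refine ⟨hinj, fun f => ?_⟩
  have h := f.2
  have h2 : f.1.totalDegree = 0 := by
    rw [MvPolynomial.totalDegree_zero_iff_isHomogeneous]
    exact h
  refine ⟨f.1.coeff 0, Subtype.ext ?_⟩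
  exact (MvPolynomial.totalDegree_eq_zero_iff_eq_C.mp h2).symm

instance gz_proper : IsProper (gzStr K) := by
  have : IsIso (CommRingCat.ofHom (algebraMap K ↥(gzA K 0))) := by
    rw [ConcreteCategory.isIso_iff_bijective]
    exact gz_zero_bij
  have : IsScalarTower K ↥(gzA K 0) (MvPolynomial (Fin 2) K) :=
    ⟨fun a b c => smul_mul_assoc a b.1 c⟩
  have : Algebra.FiniteType ↥(gzA K 0) (MvPolynomial (Fin 2) K) :=
    Algebra.FiniteType.of_restrictScalars_finiteType K _ _
  rw [gzStr]
  infer_instance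

lemma gz_point2 {Y Y' : Scheme} (g : Y ⟶ gzP K) (g' : Y' ⟶ gzP K) (y : Y) (y' : Y') (L : Type)
    [Field L] (δ : Y.residueField y ⟶ CommRingCat.of L) (δ' : Y'.residueField y' ⟶ CommRingCat.of L)
    (h : Spec.map δ ≫ Y.fromSpecResidueField y ≫ g = Spec.map δ' ≫ Y'.fromSpecResidueField y' ≫ g') :
    ∃ c : L, ∀ j, δ (gzCrd g y j) = c * δ' (gzCrd g' y' j) := by
  obtain ⟨i, hi⟩ := gz_exists_idx (g' y')
  rw [gz_fac g' y' i hi, ← Spec.map_comp_assoc] at h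
  obtain ⟨c, hc⟩ := gz_point g y L δ i _ h
  have h0 : δ' (gzCrd g' y' i) ≠ 0 := (map_ne_zero δ'.hom).mpr ((gz_crd_ne g' y' i).mpr hi)
  refine ⟨c * (δ' (gzCrd g' y' i))⁻¹, fun j => (hc j).trans ?_⟩
  have h1 : δ' (gzCrd g' y' j) = δ' (gzCrd g' y' i) * δ' (g'.residueFieldMap y'
      (gzPsi (g' y') _ hi (gzFrac i (MvPolynomial.X j) (gzX_mem j)))) :=
    (congrArg _ (gz_crd_mul g' y' i hi j)).trans (map_mul _ _ _)
  rw [h1, mul_assoc, inv_mul_cancel_left₀ h0]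
  rfl

noncomputable def gzGF {Y : Scheme} (sY : Y ⟶ Spec (CommRingCat.of K)) {m : ℕ} (l : Fin m → K)
    (v : Fin m → (Y ⟶ gzP K)) (w x : Y ⟶ gzP K) (y : Y) : Y.residueField y :=
  gzF (fun i => gzK sY y (l i)) (fun i => gzCrd (v i) y) (gzCrd w y) (gzCrd x y)

lemma gz_GF_comp {Y Y' : Scheme} (h : Y' ⟶ Y) (sY : Y ⟶ Spec (CommRingCat.of K)) {m : ℕ}
    (l : Fin m → K) (v : Fin m → (Y ⟶ gzP K)) (w x : Y ⟶ gzP K) (y : Y') :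
    gzGF (h ≫ sY) l (fun i => h ≫ v i) (h ≫ w) (h ≫ x) y =
      h.residueFieldMap y (gzGF sY l v w x (h y)) := by
  refine Eq.trans ?_ (gzF_map (h.residueFieldMap y).hom _ _ _ _)
  rw [gzGF]
  congr 1
  · funext i; rw [gzK_comp]; rfl
  · funext i j; exact gz_crd_comp _ _ _ _
  · funext j; exact gz_crd_comp _ _ _ _
  · funext j; exact gz_crd_comp _ _ _ _

lemma gz_GF_open {Y : Scheme} (sY : Y ⟶ Spec (CommRingCat.of K)) {m : ℕ} (l : Fin m → K)
    (v : Fin m → (Y ⟶ gzP K)) (w x : Y ⟶ gzP K) : IsClosed {y : Y | gzGF sY l v w x y = 0} := by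
  have := gz_open sY l (fun i => gzCrd (v i)) (gzCrd w) (gzCrd x) (fun i => gz_good_crd _)
    (gz_good_crd _) (gz_good_crd _)
  rw [← isOpen_compl_iff]
  exact this

lemma gz_pt_eq {Y Z : Scheme} (f g : Y ⟶ Z) (y : Y)
    (h : Y.fromSpecResidueField y ≫ f = Y.fromSpecResidueField y ≫ g) : f y = g y := by
  have h1 : ∀ (f : Y ⟶ Z) (p : Spec (Y.residueField y)), (Y.fromSpecResidueField y ≫ f) p = f y := by
    intro f p
    rw [Scheme.Hom.comp_apply, Scheme.fromSpecResidueField_apply]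
  rw [← h1 f default, ← h1 g default, h]

section

variable {S : Scheme} (sS : S ⟶ Spec (CommRingCat.of K))

noncomputable def gzSig (u : S ⟶ gzP K) (hu : u ≫ gzStr K = sS) : S ⟶ pullback sS (gzStr K) :=
  pullback.lift (𝟙 S) u (by rw [Category.id_comp, hu])

@[simp]
lemma gzSig_fst (u : S ⟶ gzP K) (hu : u ≫ gzStr K = sS) :
    gzSig sS u hu ≫ pullback.fst sS (gzStr K) = 𝟙 S := pullback.lift_fst _ _ _

@[simp]
lemma gzSig_snd (u : S ⟶ gzP K) (hu : u ≫ gzStr K = sS) :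
    gzSig sS u hu ≫ pullback.snd sS (gzStr K) = u := pullback.lift_snd _ _ _

@[simp]
lemma gzSig_fst_assoc (u : S ⟶ gzP K) (hu : u ≫ gzStr K = sS) {Z : Scheme} (h : S ⟶ Z) :
    gzSig sS u hu ≫ pullback.fst sS (gzStr K) ≫ h = h := by
  rw [← Category.assoc, gzSig_fst, Category.id_comp]

lemma gz_br_sec (u u' : S ⟶ gzP K) (hu : u ≫ gzStr K = sS) (hu' : u' ≫ gzStr K = sS) (s : S)
    (h : gzBr (gzCrd u s) (gzCrd u' s) = 0) : gzSig sS u hu s = gzSig sS u' hu' s := by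
  apply gz_pt_eq
  apply pullback.hom_ext
  · simp
  · simpa using gz_eq_of_br u u' s (hu.trans hu'.symm) h

lemma gz_br_graph (u : S ⟶ gzP K) (hu : u ≫ gzStr K = sS) (x : ↥(pullback sS (gzStr K)))
    (h : gzBr (gzCrd (pullback.snd sS (gzStr K)) x) (gzCrd (pullback.fst sS (gzStr K) ≫ u) x) = 0) :
    x = gzSig sS u hu (pullback.fst sS (gzStr K) x) := by
  have h1 := gz_eq_of_br _ _ x (by rw [Category.assoc, hu, pullback.condition]) h
  have := gz_pt_eq (𝟙 _) (pullback.fst sS (gzStr K) ≫ gzSig sS u hu) x (by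
    apply pullback.hom_ext
    · simp
    · simpa using h1)
  simpa using this

lemma gz_affine (V : S.Opens) (hV : IsAffineOpen V) (f : MvPolynomial (Fin 2) K) {d : ℕ}
    (hf : f ∈ gzA K d) (hd : 0 < d) :
    IsAffineOpen (pullback.fst sS (gzStr K) ⁻¹ᵁ V ⊓
      pullback.snd sS (gzStr K) ⁻¹ᵁ Proj.basicOpen (gzA K) f) := by
  have : IsAffine V := hV
  have e1 : (V.ι ≫ sS) ≫ 𝟙 _ = V.ι ≫ sS := Category.comp_id _
  have e2 : (Proj.awayι (gzA K) f hf hd ≫ gzStr K) ≫ 𝟙 _ = Proj.awayι (gzA K) f hf hd ≫ gzStr K :=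
    Category.comp_id _
  have h := isAffineOpen_opensRange (pullback.map _ _ _ _ _ _ _ e1 e2)
  convert h
  ext1
  have h3 := Scheme.Pullback.range_map _ _ _ _ _ _ _ e1 e2
  have h4 : Set.range (Proj.awayι (gzA K) f hf hd) = Proj.basicOpen (gzA K) f :=
    congrArg (SetLike.coe) (Proj.opensRange_awayι (gzA K) f hf hd)
  rw [h4, Scheme.Opens.range_ι] at h3
  exact h3.symm

end

end GZGeo

section GZGeo
variable {K : Type} [Field K]
variable {S : Scheme} (sS : S ⟶ Spec (CommRingCat.of K))

noncomputable def gzT {m : ℕ} (l : Fin m → K) (v : Fin m → (S ⟶ gzP K)) (w : S ⟶ gzP K) :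
    Set ↥(pullback sS (gzStr K)) :=
  {x | gzGF (pullback.fst sS (gzStr K) ≫ sS) l (fun i => pullback.fst sS (gzStr K) ≫ v i)
    (pullback.fst sS (gzStr K) ≫ w) (pullback.snd sS (gzStr K)) x = 0}

lemma gz_T_sec {m : ℕ} (l : Fin m → K) (v : Fin m → (S ⟶ gzP K)) (w : S ⟶ gzP K)
    (u : S ⟶ gzP K) (hu : u ≫ gzStr K = sS) (s : S) (h : gzSig sS u hu s ∈ gzT sS l v w) :
    gzGF sS l v w u s = 0 := by
  have h1 := gz_GF_comp (gzSig sS u hu) (pullback.fst sS (gzStr K) ≫ sS) l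
    (fun i => pullback.fst sS (gzStr K) ≫ v i)
    (pullback.fst sS (gzStr K) ≫ w) (pullback.snd sS (gzStr K)) s
  simp only [gzSig_fst_assoc, gzSig_snd] at h1
  rw [h1]
  exact (congrArg _ h).trans (map_zero _)

lemma gz_T_lam [IsAlgClosed K] [LocallyOfFiniteType sS] {m : ℕ} (hm : 2 ≤ m)
    (v : Fin m → (S ⟶ gzP K)) (w : S ⟶ gzP K)
    (hvw : ∀ i s, gzBr (gzCrd (v i) s) (gzCrd w s) ≠ 0)
    (hv : ∀ i j, i ≠ j → ∀ s, gzBr (gzCrd (v i) s) (gzCrd (v j) s) ≠ 0)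
    (z : ↥(pullback sS (gzStr K))) (hz : IsClosed ({z} : Set _))
    (hzv : ∀ i, gzBr (gzCrd (pullback.snd sS (gzStr K)) z)
      (gzCrd (pullback.fst sS (gzStr K) ≫ v i) z) ≠ 0)
    (hzw : gzBr (gzCrd (pullback.snd sS (gzStr K)) z)
      (gzCrd (pullback.fst sS (gzStr K) ≫ w) z) ≠ 0) :
    ∃ l : Fin m → K, (∀ i, l i ≠ 0) ∧ ∑ i, l i ≠ 0 ∧ z ∈ gzT sS l v w := by
  have : Infinite K := IsAlgClosed.instInfinite
  let e := residueFieldIsoBase (pullback.fst sS (gzStr K) ≫ sS) z hz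
  let E : (pullback sS (gzStr K)).residueField z →+* K := e.hom.hom
  have hE : ∀ c : K, E (gzK (pullback.fst sS (gzStr K) ≫ sS) z c) = c := by
    intro c
    have h1 : gzK (pullback.fst sS (gzStr K) ≫ sS) z = e.inv := by
      apply Spec.map_injective
      rw [gzK_spec, SpecMap_residueFieldIsoBase_inv]
    rw [h1]
    exact congr($(e.inv_hom_id).hom c)
  have hcomp : ∀ (a b : S ⟶ gzP K), (∀ s, gzBr (gzCrd a s) (gzCrd b s) ≠ 0) →
      gzBr (gzCrd (pullback.fst sS (gzStr K) ≫ a) z) (gzCrd (pullback.fst sS (gzStr K) ≫ b) z) ≠ 0 := by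
    intro a b hab
    have h2 := gzBr_map ((pullback.fst sS (gzStr K)).residueFieldMap z).hom
      (gzCrd a (pullback.fst sS (gzStr K) z)) (gzCrd b (pullback.fst sS (gzStr K) z))
    have h3 : ∀ a : S ⟶ gzP K, gzCrd (pullback.fst sS (gzStr K) ≫ a) z =
      ((pullback.fst sS (gzStr K)).residueFieldMap z).hom ∘ (gzCrd a (pullback.fst sS (gzStr K) z)) :=
      fun a => funext fun j => gz_crd_comp _ _ _ _
    rw [h3, h3, h2]
    exact (map_ne_zero _).mpr (hab _)
  have hEb : ∀ x y, gzBr x y ≠ 0 → gzBr (E ∘ x) (E ∘ y) ≠ 0 := by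
    intro x y h
    rw [gzBr_map]
    exact (map_ne_zero E).mpr h
  obtain ⟨l, hl, hl', hF⟩ := gz_exists_lam hm
    (fun i => E ∘ gzCrd (pullback.fst sS (gzStr K) ≫ v i) z)
    (E ∘ gzCrd (pullback.fst sS (gzStr K) ≫ w) z) (E ∘ gzCrd (pullback.snd sS (gzStr K)) z)
    (fun i => hEb _ _ (hcomp _ _ (hvw i))) (fun i j hij => hEb _ _ (hcomp _ _ (hv i j hij)))
    (hEb _ _ hzw) (fun i => hEb _ _ (hzv i))
  refine ⟨l, hl, hl', E.injective ?_⟩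
  rw [map_zero, ← hF, gzGF, ← gzF_map]
  congr 1
  funext i
  exact hE _

lemma gz_T_aff {m : ℕ} (l : Fin m → K) (v : Fin m → (S ⟶ gzP K)) (w : S ⟶ gzP K) (a : Fin 2 → K)
    (x : ↥(pullback sS (gzStr K))) (hx : x ∈ gzT sS l v w)
    (ha : gzF (fun i => gzK sS (pullback.fst sS (gzStr K) x) (l i))
      (fun i => gzCrd (v i) (pullback.fst sS (gzStr K) x)) (gzCrd w (pullback.fst sS (gzStr K) x))
      (fun j => gzK sS (pullback.fst sS (gzStr K) x) (a j)) ≠ 0) :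
    pullback.snd sS (gzStr K) x ∈ Proj.basicOpen (gzA K) (gzLin a) := by
  by_contra hD
  have h0 := gz_lin _ a hD
  have h1 := gzBr_map ((pullback.snd sS (gzStr K)).residueFieldMap x).hom
    (gzCrd0 (pullback.snd sS (gzStr K) x)) (gzK (gzStr K) (pullback.snd sS (gzStr K) x) ∘ a)
  rw [h0, map_zero] at h1
  obtain ⟨c, hc⟩ := gz_smul_of_br _ _ (gz_crd_ne_zero (pullback.snd sS (gzStr K)) x) h1
  have hK : ∀ b : K, ((pullback.snd sS (gzStr K)).residueFieldMap x).hom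
      (gzK (gzStr K) (pullback.snd sS (gzStr K) x) b) = gzK (pullback.fst sS (gzStr K) ≫ sS) x b := by
    intro b
    rw [pullback.condition, gzK_comp (pullback.snd sS (gzStr K)) (gzStr K) x]; rfl
  have hK' : ∀ b : K, ((pullback.fst sS (gzStr K)).residueFieldMap x).hom
      (gzK sS (pullback.fst sS (gzStr K) x) b) = gzK (pullback.fst sS (gzStr K) ≫ sS) x b := by
    intro b
    rw [gzK_comp]; rfl
  apply (map_ne_zero ((pullback.fst sS (gzStr K)).residueFieldMap x).hom).mpr ha
  rw [← gzF_map]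
  have h5 := gzF_smul (fun i => gzK (pullback.fst sS (gzStr K) ≫ sS) x (l i))
    (fun i => gzCrd (pullback.fst sS (gzStr K) ≫ v i) x)
    (fun i => gzCrd (pullback.fst sS (gzStr K) ≫ v i) x)
    (gzCrd (pullback.fst sS (gzStr K) ≫ w) x) (fun j => gzK (pullback.fst sS (gzStr K) ≫ sS) x (a j))
    (gzCrd (pullback.fst sS (gzStr K) ≫ w) x) (gzCrd (pullback.snd sS (gzStr K)) x)
    (fun _ => 1) 1 c (fun i j => (one_mul _).symm) (fun j => (one_mul _).symm)
    (fun j => (hK _).symm.trans (hc j))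
  have h6 : gzF (fun i => gzK (pullback.fst sS (gzStr K) ≫ sS) x (l i))
    (fun i => gzCrd (pullback.fst sS (gzStr K) ≫ v i) x) 
    (gzCrd (pullback.fst sS (gzStr K) ≫ w) x) (gzCrd (pullback.snd sS (gzStr K)) x) = 0 := hx
  rw [h6, mul_zero] at h5
  rw [← h5]
  congr 1
  · funext i; exact hK' _
  · funext i j; exact (gz_crd_comp _ _ _ _).symm
  · funext j; exact (gz_crd_comp _ _ _ _).symm
  · funext j; exact hK' _

lemma gz_T_surj {m : ℕ} (hm : 2 ≤ m) (l : Fin m → K) (v : Fin m → (S ⟶ gzP K)) (w : S ⟶ gzP K)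
    (s : S) : ∃ x ∈ gzT sS l v w, pullback.fst sS (gzStr K) x = s := by
  let L : Type := AlgebraicClosure (S.residueField s)
  let J : S.residueField s ⟶ CommRingCat.of L :=
    CommRingCat.ofHom (algebraMap (S.residueField s) (AlgebraicClosure (S.residueField s)))
  obtain ⟨x, hx0, hx⟩ := gz_exists_root (L := L) hm (fun i => J (gzK sS s (l i)))
    (fun i j => J (gzCrd (v i) s j)) (fun j => J (gzCrd w s j))
  obtain ⟨i, hi⟩ : ∃ i, x i ≠ 0 := by
    by_contra! h
    exact hx0 (funext h)
  obtain ⟨f, hfK, hf⟩ := gz_away_hom_exists i (gzK sS s ≫ J).hom x hi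
  have hcond : (Spec.map J ≫ S.fromSpecResidueField s) ≫ sS = (Spec.map (CommRingCat.ofHom f) ≫
      Proj.awayι (gzA K) _ (gzX_mem i) one_pos) ≫ gzStr K := by
    rw [Category.assoc, Category.assoc, gz_away_str, ← gzK_spec, ← Spec.map_comp, ← Spec.map_comp]
    congr 1
    ext c
    exact (hfK c).symm
  let h : Spec (CommRingCat.of L) ⟶ pullback sS (gzStr K) := pullback.lift _ _ hcond
  have h1 : h ≫ pullback.fst sS (gzStr K) = Spec.map J ≫ S.fromSpecResidueField s :=
    pullback.lift_fst _ _ _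
  have h2 : h ≫ pullback.snd sS (gzStr K) = Spec.map (CommRingCat.ofHom f) ≫
      Proj.awayι (gzA K) _ (gzX_mem i) one_pos := pullback.lift_snd _ _ _
  let x0 : ↥(pullback sS (gzStr K)) := h (IsLocalRing.closedPoint L)
  let δ : (pullback sS (gzStr K)).residueField x0 ⟶ CommRingCat.of L :=
    Scheme.descResidueField (Scheme.stalkClosedPointTo h)
  have hδ : Spec.map δ ≫ (pullback sS (gzStr K)).fromSpecResidueField x0 = h :=
    Scheme.descResidueField_stalkClosedPointTo_fromSpecResidueField L _ h
  have hv : ∀ u : S ⟶ gzP K, ∃ c : L, ∀ j, δ (gzCrd (pullback.fst sS (gzStr K) ≫ u) x0 j) =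
      c * J (gzCrd u s j) := by
    intro u
    apply gz_point2
    rw [← Category.assoc, hδ, ← Category.assoc, h1, Category.assoc]
  have hK : ∀ c, δ (gzK (pullback.fst sS (gzStr K) ≫ sS) x0 c) = J (gzK sS s c) := by
    have : gzK (pullback.fst sS (gzStr K) ≫ sS) x0 ≫ δ = gzK sS s ≫ J := by
      apply Spec.map_injective
      rw [Spec.map_comp, Spec.map_comp, gzK_spec, gzK_spec, ← Category.assoc, hδ, ← Category.assoc,
        h1, Category.assoc]
    intro c
    exact congr(($this).hom c)
  obtain ⟨e, he⟩ := gz_point (pullback.snd sS (gzStr K)) x0 L δ i f (by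
    rw [← Category.assoc, hδ, h2])
  choose c hc using fun i => hv (v i)
  obtain ⟨d, hd⟩ := hv w
  refine ⟨x0, ?_, ?_⟩
  · have hinj : Function.Injective δ.hom := δ.hom.injective
    apply hinj
    rw [map_zero, gzGF, ← gzF_map]
    have h5 := gzF_smul (fun i => J (gzK sS s (l i)))
      (fun i j => δ (gzCrd (pullback.fst sS (gzStr K) ≫ v i) x0 j)) (fun i j => J (gzCrd (v i) s j))
      (fun j => δ (gzCrd (pullback.fst sS (gzStr K) ≫ w) x0 j))
      (fun j => δ (gzCrd (pullback.snd sS (gzStr K)) x0 j))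
      (fun j => J (gzCrd w s j)) x c d (e * (x i)⁻¹) hc hd (fun j => by
        rw [he j, ← hf j, mul_assoc, inv_mul_cancel_left₀ hi])
    rw [hx, mul_zero] at h5
    rw [← h5]
    congr 1
    funext i
    exact hK _
  · obtain ⟨p, hp⟩ : ∃ p : Spec (CommRingCat.of L), h p = x0 := ⟨_, rfl⟩
    rw [← hp, ← Scheme.Hom.comp_apply, h1, Scheme.Hom.comp_apply, Scheme.fromSpecResidueField_apply]

theorem gz_main [IsAlgClosed K] [LocallyOfFiniteType sS] {m : ℕ} (hm : 2 ≤ m)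
    (v : Fin m → (S ⟶ gzP K)) (w : S ⟶ gzP K)
    (hvs : ∀ i, v i ≫ gzStr K = sS) (hws : w ≫ gzStr K = sS)
    (hvw : ∀ i s, gzBr (gzCrd (v i) s) (gzCrd w s) ≠ 0)
    (hv : ∀ i j, i ≠ j → ∀ s, gzBr (gzCrd (v i) s) (gzCrd (v j) s) ≠ 0)
    (z : ↥(pullback sS (gzStr K))) (hz : IsClosed ({z} : Set _))
    (hzv : ∀ i, gzBr (gzCrd (pullback.snd sS (gzStr K)) z)
      (gzCrd (pullback.fst sS (gzStr K) ≫ v i) z) ≠ 0)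
    (hzw : gzBr (gzCrd (pullback.snd sS (gzStr K)) z)
      (gzCrd (pullback.fst sS (gzStr K) ≫ w) z) ≠ 0) :
    ∃ T : Set ↥(pullback sS (gzStr K)), IsClosed T ∧ z ∈ T ∧
      (∀ i s, gzSig sS (v i) (hvs i) s ∉ T) ∧ (∀ s, gzSig sS w hws s ∉ T) ∧
      ∀ (Z : Scheme) (ι : Z ⟶ pullback sS (gzStr K)),
        IsClosedImmersion ι → Set.range ι = T →
          IsFinite (ι ≫ pullback.fst sS (gzStr K)) ∧
            Surjective (ι ≫ pullback.fst sS (gzStr K)) := by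
  have : Infinite K := IsAlgClosed.instInfinite
  obtain ⟨l, hl, hl', hzT⟩ := gz_T_lam sS hm v w hvw hv z hz hzv hzw
  have hlK : ∀ s i, gzK sS s (l i) ≠ 0 := fun s i => (map_ne_zero (gzK sS s).hom).mpr (hl i)
  have hlK' : ∀ s, ∑ i, gzK sS s (l i) ≠ 0 := fun s => by
    have h1 := (map_ne_zero (gzK sS s).hom).mpr hl'
    rw [map_sum] at h1
    exact h1
  have hlast : ∀ s, gzGF sS l v w w s ≠ 0 := fun s => gzF_last _ _ _ (hlK' s) (fun i => hvw i s)
  refine ⟨gzT sS l v w, gz_GF_open _ _ _ _ _, hzT, fun i s h => ?_, fun s h => ?_, ?_⟩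
  · refine gzF_at _ _ _ (hlK s) (fun i => hvw i s) (fun i j hij => hv i j hij s) i
      (gz_T_sec sS l v w (v i) (hvs i) s h)
  · exact hlast s (gz_T_sec sS l v w w hws s h)
  intro Z ι hι hr
  constructor
  · rw [IsFinite.iff_isProper_and_isAffineHom]
    refine ⟨inferInstance, isAffineHom_of_forall_exists_isAffineOpen _ fun s => ?_⟩
    obtain ⟨a, ha⟩ := gz_exists_pt (gzK sS s).hom _ _ _ _ (hlast s)
    let U : S.Opens := ⟨_, gz_open sS l (fun i => gzCrd (v i)) (gzCrd w) (fun s j => gzK sS s (a j))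
      (fun i => gz_good_crd _) (gz_good_crd _) (gz_good_const sS a)⟩
    have hsU : s ∈ U := ha
    obtain ⟨V, hV, hsV, hVU⟩ := exists_isAffineOpen_mem_and_subset hsU
    refine ⟨V, hsV, hV, ?_⟩
    have h1 := (gz_affine sS V hV (gzLin a) (gzLin_mem a) one_pos).preimage ι
    convert h1 using 1
    ext t
    constructor
    · intro ht
      refine ⟨ht, ?_⟩
      refine gz_T_aff sS l v w a (ι t) (hr ▸ ⟨t, rfl⟩) ?_
      exact hVU ht
    · intro ht
      exact ht.1
  · refine ⟨fun s => ?_⟩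
    obtain ⟨x, hx, hxs⟩ := gz_T_surj sS hm l v w s
    rw [← hr] at hx
    obtain ⟨t, rfl⟩ := hx
    exact ⟨t, hxs⟩

end GZGeo

/-- Genus-zero strong lifting: given `n ≥ 3` morphisms `r_i : S ⟶ ℙ¹_K` over
`K` with pairwise disjoint graphs `Γ_i ⊆ S ×_K ℙ¹_K`, every closed point `z` of `S ×_K ℙ¹_K`
off the graphs lies on a closed subset `T` disjoint from all `Γ_i` such that the first
projection restricted to `T` (with its reduced induced closed subscheme structure, represented
by any reduced scheme `Z` with a closed immersion onto `T`) is finite and surjective over `S`. -/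
theorem genus_zero_strong_lifting
    (K : Type) [Field K] [IsAlgClosed K]
    (S : Scheme) (sS : S ⟶ Spec (CommRingCat.of K)) (hS : IsVarietyOver K S sS)
    (n : ℕ) (hn : 3 ≤ n)
    (r : Fin n → (S ⟶ ProjLine K)) (hr : ∀ i, r i ≫ ProjLine.structMap K = sS)
    (hdisj : ∀ i j, i ≠ j →
      Disjoint (graphSet K S sS (r i) (hr i)) (graphSet K S sS (r j) (hr j)))
    (z : ↥(pullback sS (ProjLine.structMap K))) (hz : IsClosed ({z} : Set _))
    (hzΓ : ∀ i, z ∉ graphSet K S sS (r i) (hr i)) :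
    ∃ T : Set ↥(pullback sS (ProjLine.structMap K)), IsClosed T ∧ z ∈ T ∧
      (∀ i, T ∩ graphSet K S sS (r i) (hr i) = ∅) ∧
      ∀ (Z : Scheme) (ι : Z ⟶ pullback sS (ProjLine.structMap K)),
        IsClosedImmersion ι → IsReduced Z → Set.range ι.base = T →
          IsFinite (ι ≫ pullback.fst sS (ProjLine.structMap K)) ∧
            Surjective (ι ≫ pullback.fst sS (ProjLine.structMap K)) := by
  obtain ⟨-, -, hft, -⟩ := hS
  obtain ⟨m, rfl⟩ : ∃ m, n = m + 1 := ⟨n - 1, by omega⟩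
  have hbr : ∀ i j, i ≠ j → ∀ s, gzBr (gzCrd (K := K) (r i) s) (gzCrd (K := K) (r j) s) ≠ 0 := by
    intro i j hij s h
    have h1 := gz_br_sec sS (r i) (r j) (hr i) (hr j) s h
    exact Set.disjoint_left.mp (hdisj i j hij) ⟨s, rfl⟩ ⟨s, h1.symm⟩
  have hzbr : ∀ i, gzBr (gzCrd (K := K) (pullback.snd sS (gzStr K)) z)
      (gzCrd (K := K) (pullback.fst sS (gzStr K) ≫ r i) z) ≠ 0 := by
    intro i h
    exact hzΓ i ⟨_, (gz_br_graph sS (r i) (hr i) z h).symm⟩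
  obtain ⟨T, hT, hzT, hTv, hTw, hfin⟩ := gz_main sS (m := m) (by omega)
    (fun i => r i.castSucc) (r (Fin.last m)) (fun i => hr _) (hr _)
    (fun i s => hbr _ _ (Fin.castSucc_lt_last i).ne s)
    (fun i j hij s => hbr _ _ (fun h => hij (Fin.castSucc_injective m h)) s) z hz
    (fun i => hzbr _) (hzbr _)
  refine ⟨T, hT, hzT, fun i => ?_, fun Z ι hι _ hrg => hfin Z ι hι hrg⟩
  rw [Set.eq_empty_iff_forall_notMem]
  rintro _ ⟨hx, s, rfl⟩
  induction i using Fin.lastCases with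
  | last => exact hTw s hx
  | cast i => exact hTv i s hx
end
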